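/- The Vietoris hyperspace ℱ(𝔈) of all nonempty finite subsets of Erdős space 𝔈 is homeomorphic to 𝔈. -/

import Mathlib

open Set Topology Filter

/-- The Vietoris topology on `Set X` induced by a topology `t` on `X`, generated by the
subbasic sets `{F | F ⊆ U}` and `{F | F ∩ U ≠ ∅}` for `U` open in `t`. -/
def vietoris {X : Type*} (t : TopologicalSpace X) : TopologicalSpace (Set X) :=
  TopologicalSpace.generateFrom
    {S | (∃ U : Set X, IsOpen[t] U ∧ S = {F : Set X | F ⊆ U}) ∨
         (∃ U : Set X, IsOpen[t] U ∧ S = {F : Set X | (F ∩ U).Nonempty})}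

/-- `ℱ(X)`: the hyperspace of nonempty finite subsets of `X`. -/
def FinHyp (X : Type*) : Type _ := {F : Set X // F.Finite ∧ F.Nonempty}

noncomputable instance FinHyp.instCoeOut {X : Type*} : CoeOut (FinHyp X) (Set X) :=
  ⟨Subtype.val⟩

/-- `ℱ(X)` carries the (subspace) Vietoris topology. -/
instance FinHyp.instTopologicalSpace {X : Type*} [t : TopologicalSpace X] :
    TopologicalSpace (FinHyp X) :=
  (vietoris t).induced Subtype.val

/-- Erdős space: the set of square-summable sequences of rationals, as a subspace of the
real Hilbert space `ℓ²`. -/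
noncomputable abbrev ErdosSpace : Type :=
  {x : lp (fun _ : ℕ => ℝ) 2 // ∀ n : ℕ, ∃ q : ℚ, x n = (q : ℝ)}

/-- `x` and `y` carry the same first `n` labels. -/
def Near {X : Type*} (u : ℕ → X → ℕ) (n : ℕ) (x y : X) : Prop := ∀ i < n, u i x = u i y

namespace Near

variable {X : Type*} {u : ℕ → X → ℕ} {m n : ℕ} {x y z : X}

theorem refl (u : ℕ → X → ℕ) (n : ℕ) (x : X) : Near u n x x := fun _ _ => rfl

theorem symm (h : Near u n x y) : Near u n y x := fun i hi => (h i hi).symm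

theorem trans (h : Near u n x y) (h' : Near u n y z) : Near u n x z :=
  fun i hi => (h i hi).trans (h' i hi)

theorem mono (hmn : m ≤ n) (h : Near u n x y) : Near u m x y :=
  fun i hi => h i (hi.trans_le hmn)

end Near

/-- A presentation of a space as the graph of a lower semicontinuous function `φ` over the
zero-dimensional space determined by the labels `u`, together with countably many
lower semicontinuous ranks `L k`. -/
structure ErdosPresentation (X : Type*) [TopologicalSpace X] where
  u : ℕ → X → ℕ
  L : ℕ → X → ℕ
  φ : X → ℝ
  φ_nonneg : ∀ x, 0 ≤ φ x
  isInducing : IsInducing fun x => ((fun i => u i x : ℕ → ℕ), φ x)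
  ext_label : ∀ x y, (∀ i, u i x = u i y) → x = y
  L_lsc : ∀ k x, ∃ n, ∀ y, Near u n x y → L k x ≤ L k y
  φ_lsc : ∀ x, ∀ ε > 0, ∃ n, ∀ y, Near u n x y → φ x - ε < φ y
  exists_cluster : ∀ s : ℕ → X, (∃ M, ∀ n, φ (s n) ≤ M) →
    (∀ k, ∃ a, ∀ᶠ n in atTop, L k (s n) = a) → ∃ x, ∀ m, ∃ᶠ n in atTop, Near u m x (s n)
  exists_raise : ∀ p j m, ∀ δ ≥ 0, ∀ ε > 0, ∃ q, Near u m p q ∧ (∀ k < j, L k q = L k p) ∧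
    L j q ≠ L j p ∧ |φ q - φ p - δ| < ε
  exists_spread : ∀ p n m, ∀ ε > 0, ∃ g : X → ℕ, (∀ x, ∃ r, ∀ y, Near u r x y → g y = g x) ∧
    ∀ M, ∃ x, Near u m p x ∧ (∀ k < n, L k x = L k p) ∧ φ x < φ p + ε ∧ M ≤ g x

/-- The type of move encoded by the `a`-th child of a node of level `n`. -/
def childType (n a : ℕ) : ℕ × ℕ := (min n a.unpair.1, a.unpair.2.unpair.1)

theorem infinite_childType_fiber {n j : ℕ} (hj : j ≤ n) (i : ℕ) :
    {a | childType n a = (j, i)}.Infinite := by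
  refine Set.infinite_of_injective_forall_mem
    (f := fun m : ℕ => Nat.pair j (Nat.pair i m)) ?_ ?_
  · intro a b hab
    simpa [Nat.pair_eq_pair] using hab
  · intro m
    simp [childType, hj]

theorem exists_equiv_comp_eq {α β γ : Type*} [Countable α] [Countable β] (f : α → γ) (g : β → γ)
    (h : ∀ c, (Infinite {a // f a = c} ∧ Infinite {b // g b = c}) ∨
      (IsEmpty {a // f a = c} ∧ IsEmpty {b // g b = c})) :
    ∃ e : α ≃ β, ∀ a, g (e a) = f a := by
  have key : ∀ c, Nonempty ({a // f a = c} ≃ {b // g b = c}) := by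
    intro c
    rcases h c with ⟨h1, h2⟩ | ⟨h1, h2⟩
    · exact nonempty_equiv_of_countable
    · exact ⟨Equiv.equivOfIsEmpty _ _⟩
  choose e he using fun c => (⟨(key c).some, trivial⟩ :
    ∃ _ : {a // f a = c} ≃ {b // g b = c}, True)
  refine ⟨(Equiv.sigmaFiberEquiv f).symm.trans
    ((Equiv.sigmaCongrRight e).trans (Equiv.sigmaFiberEquiv g)), fun a => ?_⟩
  exact (e (f a) ⟨a, rfl⟩).2

/-- The sequences that are codes of points, for any presentation. -/
def modelCodes : Set (ℕ → ℕ) :=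
  {σ | (∀ k, ∀ᶠ n in atTop, k < (childType n (σ n)).1) ∧
    Summable fun n => ((childType n (σ n)).2 : ℝ) / 2 ^ n}

/-- The total raise of a code. -/
noncomputable def modelHeight (σ : ℕ → ℕ) : ℝ :=
  ∑' n, ((childType n (σ n)).2 : ℝ) / 2 ^ n

namespace ErdosPresentation

variable {X : Type*} [TopologicalSpace X] (P : ErdosPresentation X)

/-- The ball of labels of length `m` around `p` has `p` as an approximate minimum of the first
`n` ranks and of `φ`. -/
def Adapted (n : ℕ) (s : X × ℕ) : Prop :=
  ∀ x, Near P.u s.2 s.1 x → (∀ k < n, P.L k s.1 ≤ P.L k x) ∧ P.φ s.1 ≤ P.φ x + (1 / 2) ^ n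

/-- The first rank below `n` that changes between `p` and `q`, and the amount by which `φ`
is raised, in units of `2⁻ⁿ`. -/
noncomputable def moveType (n : ℕ) (p q : X) : ℕ × ℕ :=
  (sInf {k | k = n ∨ P.L k q ≠ P.L k p}, ⌊2 ^ n * (P.φ q - P.φ p)⌋₊)

theorem moveType_fst_le (n : ℕ) (p q : X) : (P.moveType n p q).1 ≤ n :=
  Nat.sInf_le (Or.inl rfl)

theorem eq_of_lt_moveType {n k : ℕ} {p q : X} (h : k < (P.moveType n p q).1) :
    P.L k q = P.L k p := by
  by_contra hne
  exact Nat.notMem_of_lt_sInf h (Or.inr hne)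

theorem lt_moveType {n k : ℕ} {p q : X} (hk : k < n) (h : ∀ i ≤ k, P.L i q = P.L i p) :
    k < (P.moveType n p q).1 := by
  by_contra! hle
  have hmem : sInf {k | k = n ∨ P.L k q ≠ P.L k p} ∈ {k | k = n ∨ P.L k q ≠ P.L k p} :=
    Nat.sInf_mem ⟨n, Or.inl rfl⟩
  rcases hmem with h1 | h1
  · have : (P.moveType n p q).1 = n := h1
    omega
  · exact h1 (h _ hle)

theorem exists_adapted (n : ℕ) (x : X) : ∃ r, ∀ m ≥ r, P.Adapted n (x, m) := by
  obtain ⟨r₀, hr₀⟩ := P.φ_lsc x ((1 / 2) ^ n) (by positivity)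
  choose r hr using fun k => P.L_lsc k x
  refine ⟨max r₀ ((Finset.range n).sup r), fun m hm y hy => ⟨fun k hk => hr k y (hy.mono ?_), ?_⟩⟩
  · exact (Finset.le_sup (Finset.mem_range.2 hk)).trans ((le_max_right _ _).trans hm)
  · linarith [hr₀ y (hy.mono ((le_max_left _ _).trans hm))]

theorem exists_separating {x y : X} (h : x ≠ y) : ∃ m, ¬ Near P.u m x y := by
  by_contra! hc
  exact h (P.ext_label x y fun i => hc (i + 1) i (Nat.lt_succ_self i))

/-- Inside any ball there is a sequence of points realizing all types of moves, no two of them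
in the same fibre of some locally constant function. -/
theorem exists_moves (n m : ℕ) (p : X) :
    ∃ (g : X → ℕ) (q : ℕ → X), (∀ x, ∃ r, ∀ y, Near P.u r x y → g y = g x) ∧
      Function.Injective (fun l => g (q l)) ∧ ∀ l, Near P.u m p (q l) ∧
        P.moveType n p (q l) = childType n l := by
  obtain ⟨r₀, hr₀⟩ := P.φ_lsc p ((1 / 2) ^ n / 8) (by positivity)
  obtain ⟨g, hg, hspread⟩ := P.exists_spread p n (max m r₀) ((1 / 2) ^ n / 8) (by positivity)
  have hinf : {a | ∃ x, Near P.u (max m r₀) p x ∧ (∀ k < n, P.L k x = P.L k p) ∧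
      P.φ x < P.φ p + (1 / 2) ^ n / 8 ∧ g x = a}.Infinite := by
    refine Set.infinite_of_not_bddAbove ?_
    rintro ⟨M, hM⟩
    obtain ⟨x, h1, h2, h3, h4⟩ := hspread (M + 1)
    have := hM ⟨x, h1, h2, h3, rfl⟩
    omega
  have hx := fun l => (hinf.natEmbedding _ l).2
  choose x hx1 hx2 hx3 hx4 using hx
  choose r hr using hg
  choose q hq1 hq2 hq3 hq4 using fun l => P.exists_raise (x l) (childType n l).1
    (max (r (x l)) m) (((childType n l).2 + 1 / 2) * (1 / 2) ^ n) (by positivity)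
    ((1 / 2) ^ n / 8) (by positivity)
  have hgq : ∀ l, g (q l) = g (x l) := fun l => hr _ _ ((hq1 l).mono (le_max_left _ _))
  refine ⟨g, q, fun x => ⟨r x, hr x⟩, fun a b hab => ?_, fun l => ⟨?_, ?_⟩⟩
  · simp only [hgq, hx4] at hab
    exact (hinf.natEmbedding _).injective (Subtype.ext hab)
  · exact ((hx1 l).mono (le_max_left _ _)).trans ((hq1 l).mono (le_max_right _ _))
  · have hj : (childType n l).1 ≤ n := min_le_left _ _
    refine Prod.ext (le_antisymm ?_ ?_) ?_
    · refine Nat.sInf_le ?_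
      rcases hj.eq_or_lt with h | h
      · exact Or.inl h
      · exact Or.inr (by rw [← hx2 l _ h]; exact hq3 l)
    · by_contra! hlt
      have h1 := P.lt_moveType (p := p) (q := q l) (n := n)
        (k := (P.moveType n p (q l)).1) (hlt.trans_le hj) (fun i hi => by
          rw [hq2 l i (hi.trans_lt hlt), hx2 l i ((hi.trans_lt hlt).trans_le hj)])
      exact lt_irrefl _ h1
    · have h1 := abs_lt.1 (hq4 l)
      have h2 := hr₀ (x l) ((hx1 l).mono (le_max_right _ _))
      have h3 := hx3 l
      have hpow : (2 : ℝ) ^ n * (1 / 2) ^ n = 1 := by rw [← mul_pow]; norm_num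
      set e : ℝ := (1 / 2) ^ n
      have hpos : (0 : ℝ) < 2 ^ n := by positivity
      have hlo : ((childType n l).2 : ℝ) ≤ 2 ^ n * (P.φ (q l) - P.φ p) := by
        have : ((childType n l).2 : ℝ) * e ≤ P.φ (q l) - P.φ p := by
          have : 0 < e := by positivity
          linarith
        calc ((childType n l).2 : ℝ) = 2 ^ n * ((childType n l).2 * e) := by
              rw [mul_left_comm, hpow, mul_one]
          _ ≤ _ := by gcongr
      have hhi : 2 ^ n * (P.φ (q l) - P.φ p) < (childType n l).2 + 1 := by
        have : P.φ (q l) - P.φ p < ((childType n l).2 + 1 : ℝ) * e := by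
          have : 0 < e := by positivity
          linarith
        calc _ < 2 ^ n * (((childType n l).2 + 1 : ℝ) * e) := by gcongr
          _ = _ := by rw [mul_left_comm, hpow, mul_one]
      exact (Nat.floor_eq_iff (le_trans (by positivity) hlo)).2 ⟨hlo, hhi⟩

/-- An adapted ball of level `n` splits into countably many adapted balls of level `n + 1`,
indexed so that the `a`-th one has type `childType n a`. -/
theorem exists_children (n : ℕ) (s : X × ℕ) :
    ∃ c : ℕ → X × ℕ, (∀ a, Near P.u s.2 s.1 (c a).1 ∧ n < (c a).2 ∧ s.2 ≤ (c a).2 ∧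
        P.Adapted (n + 1) (c a) ∧ P.moveType n s.1 (c a).1 = childType n a) ∧
      ∀ x, Near P.u s.2 s.1 x → ∃! a, Near P.u (c a).2 (c a).1 x := by
  obtain ⟨p, m⟩ := s
  dsimp only
  obtain ⟨g, q, hg, hinj, hq⟩ := P.exists_moves n m p
  -- `M` is the radius of an admissible ball around `x`
  let Adm : X → ℕ → Prop := fun x M => n < M ∧ m ≤ M ∧ ∃ y, Near P.u M x y ∧
    P.Adapted (n + 1) (y, M) ∧ ∀ l, Near P.u M x (q l) → y = q l
  have adm_congr : ∀ {x y M}, Near P.u M x y → Adm x M → Adm y M := by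
    rintro x y M hxy ⟨h1, h2, z, h3, h4, h5⟩
    exact ⟨h1, h2, z, hxy.symm.trans h3, h4, fun l hl => h5 l (hxy.trans hl)⟩
  have exists_adm : ∀ x, ∃ M, Adm x M := by
    intro x
    obtain ⟨r, hr⟩ := P.exists_adapted (n + 1) x
    obtain ⟨r', hr'⟩ := hg x
    obtain ⟨r'', hr''⟩ : ∃ r'', ∀ l, g (q l) = g x → x ≠ q l → ¬ Near P.u r'' x (q l) := by
      by_cases h : ∃ l, g (q l) = g x ∧ x ≠ q l
      · obtain ⟨l, hl, hne⟩ := h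
        obtain ⟨r'', hr''⟩ := P.exists_separating hne
        refine ⟨r'', fun l' hl' _ => ?_⟩
        rwa [hinj (hl'.trans hl.symm)]
      · push Not at h
        exact ⟨0, fun l hl hne => (hne (h l hl)).elim⟩
    refine ⟨max (max (n + 1) m) (max r (max r' r'')), by omega, by omega, x, Near.refl _ _ _,
      hr _ (by omega), fun l hl => ?_⟩
    by_contra hne
    exact hr'' l (hr' _ (hl.mono (by omega))) hne (hl.mono (by omega))
  classical
  let R : X → ℕ := fun x => Nat.find (exists_adm x)
  have hR : ∀ x, Adm x (R x) := fun x => Nat.find_spec (exists_adm x)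
  have R_congr : ∀ {x y}, Near P.u (R x) x y → R y = R x := by
    intro x y hxy
    refine le_antisymm (Nat.find_min' _ (adm_congr hxy (hR x))) ?_
    by_contra! hlt
    exact Nat.find_min (exists_adm x) hlt (adm_congr (hxy.symm.mono hlt.le) (hR y))
  let b : X → ℕ × List ℕ := fun x => (R x, (List.range (R x)).map fun i => P.u i x)
  have hb : ∀ x y, b x = b y ↔ Near P.u (R x) x y := by
    intro x y
    constructor
    · intro h
      have h1 : R x = R y := congrArg Prod.fst h
      have h2 : (List.range (R x)).map (fun i => P.u i x) =
        (List.range (R y)).map fun i => P.u i y := congrArg Prod.snd h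
      rw [← h1, List.map_inj_left] at h2
      exact fun i hi => h2 i (List.mem_range.2 hi)
    · intro h
      have h1 := R_congr h
      refine Prod.ext h1.symm ?_
      change (List.range (R x)).map (fun i => P.u i x) =
        (List.range (R y)).map fun i => P.u i y
      rw [h1, List.map_inj_left]
      exact fun i hi => h i (List.mem_range.1 hi)
  let V := {v // ∃ x, Near P.u m p x ∧ b x = v}
  let mk : ∀ x, Near P.u m p x → V := fun x hx => ⟨b x, x, hx, rfl⟩
  choose x hxp hxb using fun v : V => v.2
  choose hRn hRm y hy1 hy2 hy3 using hR
  have hmem : ∀ (v : V) z, Near P.u (R (x v)) (y (x v)) z ↔ b z = v.1 := by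
    intro v z
    rw [← hxb v, eq_comm, hb]
    exact ⟨fun h => (hy1 _).trans h, fun h => (hy1 _).symm.trans h⟩
  have hyq : ∀ (v : V) l, b (q l) = v.1 → y (x v) = q l := by
    intro v l h
    rw [← hxb v, eq_comm, hb] at h
    exact hy3 _ l h
  obtain ⟨e, he⟩ := exists_equiv_comp_eq (childType n)
    (fun v : V => P.moveType n p (y (x v))) (by
      rintro ⟨j, i⟩
      by_cases hj : j ≤ n
      · refine Or.inl ⟨(infinite_childType_fiber hj i).to_subtype, ?_⟩
        have := (infinite_childType_fiber hj i).to_subtype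
        let f : {a | childType n a = (j, i)} →
            {v : V // P.moveType n p (y (x v)) = (j, i)} := fun a =>
          ⟨mk (q a.1) (hq a.1).1, by rw [hyq _ a.1 rfl, (hq a.1).2]; exact a.2⟩
        refine Infinite.of_injective f fun a a' h => ?_
        have h1 : b (q a.1) = b (q a'.1) :=
          congrArg (fun w : {v : V // P.moveType n p (y (x v)) = (j, i)} => w.1.1) h
        have h2 := hyq (mk (q a.1) (hq a.1).1) a.1 rfl
        have h3 := hyq (mk (q a.1) (hq a.1).1) a'.1 h1.symm
        exact Subtype.ext (hinj (congrArg g (h2.symm.trans h3)))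
      · refine Or.inr ⟨⟨fun a => hj ?_⟩, ⟨fun v => hj ?_⟩⟩
        · rw [← show (childType n a.1).1 = j from congrArg Prod.fst a.2]
          exact min_le_left _ _
        · rw [← show (P.moveType n p (y (x v.1))).1 = j from congrArg Prod.fst v.2]
          exact P.moveType_fst_le _ _ _)
  refine ⟨fun a => (y (x (e a)), R (x (e a))), fun a => ⟨?_, hRn _, hRm _, hy2 _, he a⟩, ?_⟩
  · exact (hxp (e a)).trans ((hy1 (x (e a))).mono (hRm _))
  · intro z hz
    refine ⟨e.symm (mk z hz), ?_, fun a ha => ?_⟩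
    · change Near P.u (R (x (e _))) (y (x (e _))) z
      rw [hmem, Equiv.apply_symm_apply]
    · rw [Equiv.eq_symm_apply]
      exact Subtype.ext ((hmem (e a) z).1 ha).symm

theorem exists_root [Nonempty X] : ∃ p, P.Adapted 0 (p, 0) := by
  have hbdd : BddBelow (range P.φ) := ⟨0, by rintro _ ⟨x, rfl⟩; exact P.φ_nonneg x⟩
  obtain ⟨p, hp⟩ := exists_lt_of_ciInf_lt (lt_add_one (⨅ x, P.φ x))
  refine ⟨p, fun x _ => ⟨fun k hk => (Nat.not_lt_zero k hk).elim, ?_⟩⟩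
  have := ciInf_le hbdd x
  simp only [pow_zero]
  linarith

/-- A presented space embeds in `(ℕ → ℕ) × ℝ` with image not depending on the presentation. -/
theorem exists_isEmbedding {X : Type*} [TopologicalSpace X] (P : ErdosPresentation X)
    [Nonempty X] : ∃ f : X → (ℕ → ℕ) × ℝ, IsEmbedding f ∧
    range f = (fun σ => (σ, modelHeight σ)) '' modelCodes := by
  obtain ⟨p₀, hp₀⟩ := P.exists_root
  choose C hC hCu using P.exists_children
  choose hC1 hC2 hC3 hC4 hC5 using hC
  choose! A hA hA' using hCu
  let node : (ℕ → ℕ) → ℕ → X × ℕ := fun σ n =>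
    Nat.rec (p₀, 0) (fun n s => C n s (σ n)) n
  have node_succ : ∀ σ n, node σ (n + 1) = C n (node σ n) (σ n) := fun σ n => rfl
  let S : X → ℕ → X × ℕ := fun x n => Nat.rec (p₀, 0) (fun n s => C n s (A n s x)) n
  let code : X → ℕ → ℕ := fun x n => A n (S x n) x
  have node_code : ∀ x n, node (code x) n = S x n := by
    intro x n
    induction n with
    | zero => rfl
    | succ n ih => rw [node_succ, ih]
  have mem_node : ∀ x n, Near P.u (node (code x) n).2 (node (code x) n).1 x := by
    intro x n
    rw [node_code]
    induction n with
    | zero => exact fun i hi => (Nat.not_lt_zero i hi).elim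
    | succ n ih => exact hA n _ x ih
  have node_congr : ∀ n σ τ, (∀ k < n, σ k = τ k) → node σ n = node τ n := by
    intro n σ τ h
    induction n with
    | zero => rfl
    | succ n ih =>
      rw [node_succ, node_succ, ih fun k hk => h k (hk.trans (Nat.lt_succ_self n)),
        h n (Nat.lt_succ_self n)]
  have node_adapted : ∀ σ n, P.Adapted n (node σ n) := by
    intro σ n
    cases n with
    | zero => exact hp₀
    | succ n => exact hC4 n _ _
  have le_node : ∀ σ n, n ≤ (node σ n).2 := by
    intro σ n
    cases n with
    | zero => exact Nat.zero_le _
    | succ n => exact hC2 n _ _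
  have node_anti : ∀ σ n x, Near P.u (node σ (n + 1)).2 (node σ (n + 1)).1 x →
      Near P.u (node σ n).2 (node σ n).1 x := fun σ n x h =>
    (hC1 n _ _).trans (h.mono (hC3 n _ _))
  have node_anti' : ∀ σ x m n, m ≤ n → Near P.u (node σ n).2 (node σ n).1 x →
      Near P.u (node σ m).2 (node σ m).1 x := by
    intro σ x m n hmn
    induction hmn with
    | refl => exact id
    | step _ ih => exact fun h => ih (node_anti _ _ _ h)
  have code_eq : ∀ n σ x, Near P.u (node σ n).2 (node σ n).1 x → ∀ k < n, code x k = σ k := by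
    intro n σ x
    induction n with
    | zero => exact fun _ k hk => (Nat.not_lt_zero k hk).elim
    | succ n ih =>
      intro h k hk
      have h' := node_anti σ n x h
      rcases (Nat.lt_succ_iff.1 hk).lt_or_eq with hk | rfl
      · exact ih h' k hk
      · have : A k (node σ k) x = σ k := (hA' k (node σ k) x h' (σ k) h).symm
        rw [← this, node_congr k σ (code x) fun i hi => (ih h' i hi).symm, node_code]
  have near_of_code : ∀ n x y, (∀ k < n, code y k = code x k) → Near P.u n x y := by
    intro n x y h
    have h1 := mem_node x n
    have h2 := mem_node y n
    rw [node_congr n _ _ h] at h2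
    exact (h1.symm.trans h2).mono (le_node _ n)
  have near_pt : ∀ x n, Near P.u n x (node (code x) n).1 := fun x n =>
    ((mem_node x n).mono (le_node _ n)).symm
  let d : ℕ → (ℕ → ℕ) → ℝ := fun n σ => P.φ (node σ (n + 1)).1 - P.φ (node σ n).1 -
    ((childType n (σ n)).2 : ℝ) / 2 ^ n
  have d_bound : ∀ n σ, ‖d n σ‖ ≤ (1 / 2) ^ n := by
    intro n σ
    have h1 : ((childType n (σ n)).2) =
        ⌊2 ^ n * (P.φ (node σ (n + 1)).1 - P.φ (node σ n).1)⌋₊ := by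
      rw [← hC5 n (node σ n) (σ n)]; rfl
    have h2 := (node_adapted σ n _ (node_anti σ n _ (Near.refl _ _ _))).2
    have hpow : ((1 : ℝ) / 2) ^ n * 2 ^ n = 1 := by rw [← mul_pow]; norm_num
    have hpos : (0 : ℝ) < 2 ^ n := by positivity
    change |P.φ (node σ (n + 1)).1 - P.φ (node σ n).1 - ((childType n (σ n)).2 : ℝ) / 2 ^ n| ≤ _
    rw [h1]
    have hvneg : -((1 / 2) ^ n) ≤ P.φ (node σ (n + 1)).1 - P.φ (node σ n).1 := by linarith
    generalize P.φ (node σ (n + 1)).1 - P.φ (node σ n).1 = v at hvneg ⊢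
    have hv : v - (⌊2 ^ n * v⌋₊ : ℝ) / 2 ^ n = (1 / 2) ^ n * (2 ^ n * v - ⌊2 ^ n * v⌋₊) := by
      rw [mul_sub, ← mul_assoc, hpow, one_mul, one_div, inv_pow]
      field_simp
    have hb : |2 ^ n * v - ⌊2 ^ n * v⌋₊| ≤ 1 := by
      rcases le_or_gt 0 (2 ^ n * v) with h | h
      · have h3 := Nat.floor_le h
        have h4 := Nat.lt_floor_add_one (2 ^ n * v)
        rw [abs_le]; constructor <;> linarith
      · rw [Nat.floor_of_nonpos h.le, Nat.cast_zero, sub_zero, abs_of_neg h]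
        have : -((1 / 2) ^ n * 2 ^ n) ≤ v * 2 ^ n := by
          rw [← neg_mul]; gcongr
        linarith
    rw [hv, abs_mul, abs_of_pos (by positivity : (0 : ℝ) < (1 / 2) ^ n)]
    exact mul_le_of_le_one_right (by positivity) hb
  have geom : Summable fun n : ℕ => ((1 : ℝ) / 2) ^ n := summable_geometric_two
  have d_summable : ∀ σ, Summable fun n => d n σ := fun σ =>
    Summable.of_norm_bounded geom fun n => d_bound n σ
  have d_cont : ∀ n, Continuous (d n) := by
    intro n
    rw [continuous_iff_continuousAt]
    intro σ
    refine (continuousAt_const (y := d n σ)).congr ?_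
    have : ∀ᶠ τ in 𝓝 σ, ∀ k ∈ Finset.range (n + 1), τ k = σ k := by
      rw [Filter.eventually_all_finset]
      intro k _
      exact (continuous_apply k).continuousAt.eventually
        ((isOpen_discrete {σ k}).mem_nhds rfl)
    filter_upwards [this] with τ hτ
    have h1 : ∀ k < n + 1, σ k = τ k := fun k hk => (hτ k (Finset.mem_range.2 hk)).symm
    simp only [d, node_congr (n + 1) σ τ h1,
      node_congr n σ τ fun k hk => h1 k (hk.trans (Nat.lt_succ_self n)),
      h1 n (Nat.lt_succ_self n)]
  have D_cont : Continuous fun σ => ∑' n, d n σ := continuous_tsum d_cont geom d_bound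
  have partial_sum : ∀ σ n, P.φ (node σ n).1 = P.φ p₀ +
      ∑ l ∈ Finset.range n, ((childType l (σ l)).2 : ℝ) / 2 ^ l +
      ∑ l ∈ Finset.range n, d l σ := by
    intro σ n
    induction n with
    | zero => simp [node]
    | succ n ih =>
      rw [Finset.sum_range_succ, Finset.sum_range_succ]
      have : d n σ = P.φ (node σ (n + 1)).1 - P.φ (node σ n).1 -
        ((childType n (σ n)).2 : ℝ) / 2 ^ n := rfl
      linarith
  have D_bound : ∀ σ n, |∑ l ∈ Finset.range n, d l σ| ≤ 2 := by
    intro σ n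
    calc |∑ l ∈ Finset.range n, d l σ| ≤ ∑ l ∈ Finset.range n, ((1 : ℝ) / 2) ^ l :=
          (Finset.abs_sum_le_sum_abs _ _).trans (Finset.sum_le_sum fun l _ => d_bound l σ)
      _ ≤ ∑' l : ℕ, ((1 : ℝ) / 2) ^ l := geom.sum_le_tsum _ fun _ _ => by positivity
      _ = 2 := tsum_geometric_two
  have φ_le : ∀ x n, P.φ (node (code x) n).1 ≤ P.φ x + (1 / 2) ^ n := fun x n =>
    (node_adapted _ n x (mem_node x n)).2
  have φ_tendsto : ∀ x, Tendsto (fun n => P.φ (node (code x) n).1) atTop (𝓝 (P.φ x)) := by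
    intro x
    have hup : Tendsto (fun n : ℕ => P.φ x + ((1 : ℝ) / 2) ^ n) atTop (𝓝 (P.φ x)) := by
      simpa using (tendsto_pow_atTop_nhds_zero_of_lt_one (r := (1 : ℝ) / 2) (by norm_num)
        (by norm_num)).const_add (P.φ x)
    refine tendsto_order.2 ⟨fun a ha => ?_, fun a ha => ?_⟩
    · obtain ⟨n, hn⟩ := P.φ_lsc x (P.φ x - a) (by linarith)
      filter_upwards [eventually_ge_atTop n] with k hk
      linarith [hn _ ((near_pt x k).mono hk)]
    · filter_upwards [hup.eventually (gt_mem_nhds ha)] with n hn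
      exact (φ_le x n).trans_lt hn
  have summable_code : ∀ x, Summable fun n => ((childType n (code x n)).2 : ℝ) / 2 ^ n := by
    intro x
    refine summable_of_sum_range_le (c := P.φ x + 1 - P.φ p₀ + 2) (fun n => by positivity) ?_
    intro n
    have h1 := partial_sum (code x) n
    have h2 := abs_le.1 (D_bound (code x) n)
    have h3 := φ_le x n
    have h4 : ((1 : ℝ) / 2) ^ n ≤ 1 := pow_le_one₀ (by norm_num) (by norm_num)
    linarith
  have φ_eq : ∀ x, P.φ x = P.φ p₀ + modelHeight (code x) + ∑' n, d n (code x) := by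
    intro x
    refine tendsto_nhds_unique (φ_tendsto x) ?_
    simp only [partial_sum]
    exact ((summable_code x).hasSum.tendsto_sum_nat.const_add _).add
      (d_summable _).hasSum.tendsto_sum_nat
  have code_mem : ∀ x, code x ∈ modelCodes := by
    intro x
    refine ⟨fun k => ?_, summable_code x⟩
    choose r hr using fun k => P.L_lsc k x
    have hL : ∀ i, ∀ n > max i (r i), P.L i (node (code x) n).1 = P.L i x := fun i n hn =>
      le_antisymm ((node_adapted (code x) n x (mem_node x n)).1 i (by omega))
        (hr i _ ((near_pt x n).mono (by omega)))
    filter_upwards [eventually_gt_atTop ((Finset.range (k + 1)).sup fun i => max i (r i))]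
      with n hn
    have hle : ∀ i ≤ k, max i (r i) < n := fun i hi =>
      (Finset.le_sup (f := fun i => max i (r i)) (Finset.mem_range.2 (by omega))).trans_lt hn
    rw [← hC5 n (node (code x) n) (code x n)]
    refine P.lt_moveType (lt_of_le_of_lt (le_max_left _ _) (hle k le_rfl)) fun i hi => ?_
    rw [← node_succ, hL i (n + 1) ((hle i hi).trans (Nat.lt_succ_self n)), hL i n (hle i hi)]
  have code_surj : ∀ σ ∈ modelCodes, ∃ x, code x = σ := by
    rintro σ ⟨h1, h2⟩
    obtain ⟨x, hx⟩ := P.exists_cluster (fun n => (node σ n).1)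
      ⟨P.φ p₀ + ∑' n, ((childType n (σ n)).2 : ℝ) / 2 ^ n + 2, fun n => by
        rw [partial_sum]
        have h3 := h2.sum_le_tsum (Finset.range n) fun _ _ => by positivity
        have h4 := abs_le.1 (D_bound σ n)
        linarith⟩ (fun k => by
        obtain ⟨N, hN⟩ := eventually_atTop.1 (h1 k)
        refine ⟨P.L k (node σ N).1, ?_⟩
        filter_upwards [eventually_ge_atTop N] with n hn
        induction n, hn using Nat.le_induction with
        | base => rfl
        | succ n hn ih =>
          rw [← ih]
          refine P.eq_of_lt_moveType (n := n) ?_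
          rw [node_succ, hC5]
          exact hN n hn)
    refine ⟨x, funext fun k => code_eq (k + 1) σ x ?_ k (Nat.lt_succ_self k)⟩
    obtain ⟨n, hnear, hn⟩ := ((hx (node σ (k + 1)).2).and_eventually
      (eventually_ge_atTop (k + 1))).exists
    exact (node_anti' σ _ _ _ hn (Near.refl _ _ _)).trans hnear.symm
  have code_inj : Function.Injective code := fun x y h =>
    P.ext_label x y fun i => near_of_code (i + 1) x y (fun k _ => by rw [h]) i (Nat.lt_succ_self i)
  have hι : ∀ x, 𝓝 x = comap (fun x => ((fun i => P.u i x : ℕ → ℕ), P.φ x))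
    (𝓝 ((fun i => P.u i x : ℕ → ℕ), P.φ x)) := fun x => P.isInducing.nhds_eq_comap x
  have hu : ∀ i, Continuous (P.u i) := fun i =>
    (continuous_apply i).comp (continuous_fst.comp P.isInducing.continuous)
  have hφ : Continuous P.φ := continuous_snd.comp P.isInducing.continuous
  have near_nhds : ∀ m x, ∀ᶠ y in 𝓝 x, Near P.u m x y := by
    intro m x
    have : ∀ᶠ y in 𝓝 x, ∀ i ∈ Finset.range m, P.u i x = P.u i y := by
      rw [Filter.eventually_all_finset]
      intro i _
      filter_upwards [(hu i).continuousAt.eventually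
        ((isOpen_discrete {P.u i x}).mem_nhds rfl)] with y hy
      exact hy.symm
    filter_upwards [this] with y hy i hi
    exact hy i (Finset.mem_range.2 hi)
  have code_cont : Continuous code := by
    refine continuous_pi fun k => continuous_iff_continuousAt.2 fun x => ?_
    refine (continuousAt_const (y := code x k)).congr ?_
    filter_upwards [near_nhds (node (code x) (k + 1)).2 x] with y hy
    have := (mem_node x (k + 1)).trans hy
    exact (code_eq (k + 1) (code x) y this k (Nat.lt_succ_self k)).symm
  have height_cont : Continuous fun x => modelHeight (code x) := by
    have : (fun x => modelHeight (code x)) =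
        fun x => P.φ x - P.φ p₀ - ∑' n, d n (code x) := by
      funext x
      linarith [φ_eq x]
    rw [this]
    exact (hφ.sub continuous_const).sub (D_cont.comp code_cont)
  refine ⟨fun x => (code x, modelHeight (code x)), ⟨isInducing_iff_nhds.2 fun x =>
    le_antisymm ?_ ?_, fun x y h => code_inj (congrArg Prod.fst h)⟩, ?_⟩
  · exact map_le_iff_le_comap.1 (code_cont.prodMk height_cont).continuousAt
  · rw [hι x, ← map_le_iff_le_comap]
    have ht := tendsto_comap (f := fun x => (code x, modelHeight (code x)))
      (x := 𝓝 (code x, modelHeight (code x)))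
    rw [nhds_prod_eq] at ht
    have h1 := tendsto_fst.comp ht
    have h2 := tendsto_snd.comp ht
    rw [← nhds_prod_eq] at h1 h2
    refine Tendsto.prodMk_nhds ?_ ?_
    · refine tendsto_pi_nhds.2 fun i => tendsto_nhds_of_eventually_eq ?_
      have h3 : ∀ᶠ y in comap (fun x => (code x, modelHeight (code x)))
          (𝓝 (code x, modelHeight (code x))), ∀ k ∈ Finset.range (i + 1),
          code y k = code x k := by
        rw [Filter.eventually_all_finset]
        intro k _
        exact (tendsto_pi_nhds.1 h1 k).eventually
          ((isOpen_discrete {code x k}).mem_nhds rfl)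
      filter_upwards [h3] with y hy
      exact (near_of_code (i + 1) x y (fun k hk => hy k (Finset.mem_range.2 hk)) i
        (Nat.lt_succ_self i)).symm
    · have : P.φ = fun x => P.φ p₀ + modelHeight (code x) + ∑' n, d n (code x) := funext φ_eq
      rw [this]
      exact (h2.const_add _).add ((D_cont.tendsto _).comp h1)
  · ext ⟨σ, t⟩
    constructor
    · rintro ⟨x, hx⟩
      exact ⟨code x, code_mem x, hx⟩
    · rintro ⟨τ, hτ, h⟩
      obtain ⟨x, rfl⟩ := code_surj τ hτ
      exact ⟨x, h⟩

theorem nonempty_homeomorph {X Y : Type*} [TopologicalSpace X] [TopologicalSpace Y]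
    [Nonempty X] [Nonempty Y] (P : ErdosPresentation X) (Q : ErdosPresentation Y) :
    Nonempty (X ≃ₜ Y) := by
  obtain ⟨f, hf, hf'⟩ := P.exists_isEmbedding
  obtain ⟨g, hg, hg'⟩ := Q.exists_isEmbedding
  exact ⟨hf.toHomeomorph.trans ((Homeomorph.setCongr (hf'.trans hg'.symm)).trans
    hg.toHomeomorph.symm)⟩

end ErdosPresentation

theorem Near.hasBasis {X : Type*} (u : ℕ → X → ℕ) (x : X) :
    (comap (fun y i => u i y) (𝓝 fun i => u i x)).HasBasis (fun _ : ℕ => True)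
      fun m => {y | Near u m x y} := by
  refine ⟨fun s => ⟨fun hs => ?_, fun ⟨m, _, hm⟩ => mem_of_superset ?_ hm⟩⟩
  · obtain ⟨t, ht, hts⟩ := hs
    rw [nhds_pi, Filter.mem_pi] at ht
    obtain ⟨I, hI, v, hv, hvt⟩ := ht
    obtain ⟨m, hm⟩ := hI.bddAbove
    refine ⟨m + 1, trivial, fun y hy => hts (hvt fun i hi => ?_)⟩
    have : u i x = u i y := hy i (Nat.lt_succ_of_le (hm hi))
    change u i y ∈ v i
    rw [← this]
    exact mem_of_mem_nhds (hv i)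
  · have : ∀ᶠ y in comap (fun y i => u i y) (𝓝 fun i => u i x), ∀ i ∈ Finset.range m,
        u i y = u i x := by
      rw [Filter.eventually_all_finset]
      intro i _
      have ht : Tendsto (fun y i => u i y) (comap (fun y i => u i y) (𝓝 fun i => u i x))
        (𝓝 fun i => u i x) := tendsto_comap
      exact (tendsto_pi_nhds.1 ht i).eventually_mem ((isOpen_discrete {u i x}).mem_nhds rfl)
    filter_upwards [this] with y hy i hi
    exact (hy i (Finset.mem_range.2 hi)).symm

namespace ErdosPresentation

theorem nhds_eq {X : Type*} [TopologicalSpace X] (P : ErdosPresentation X) (x : X) :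
    𝓝 x = comap (fun y i => P.u i y) (𝓝 fun i => P.u i x) ⊓ comap P.φ (𝓝 (P.φ x)) := by
  rw [P.isInducing.nhds_eq_comap, nhds_prod_eq, Filter.prod_eq_inf, Filter.comap_inf,
    Filter.comap_comap, Filter.comap_comap]
  rfl

theorem hasBasis_nhds {X : Type*} [TopologicalSpace X] (P : ErdosPresentation X) (x : X) :
    (𝓝 x).HasBasis (fun s : ℕ × ℝ => 0 < s.2)
      fun s => {y | Near P.u s.1 x y ∧ |P.φ y - P.φ x| < s.2} := by
  rw [P.nhds_eq]
  refine ((Near.hasBasis P.u x).inf (Metric.nhds_basis_ball.comap P.φ)).to_hasBasis ?_ ?_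
  · rintro ⟨m, ε⟩ ⟨_, h⟩
    exact ⟨(m, ε), h, fun y hy => ⟨hy.1, hy.2⟩⟩
  · rintro ⟨m, ε⟩ h
    exact ⟨(m, ε), ⟨trivial, h⟩, fun y hy => ⟨hy.1, hy.2⟩⟩

end ErdosPresentation

namespace ErdosSpace

/-- The coordinates of a point of Erdős space. -/
def coord (x : ErdosSpace) : ℕ → ℝ := fun k => x.1 k

/-- The rational coordinates of a point of Erdős space. -/
noncomputable def ratCoord (x : ErdosSpace) (k : ℕ) : ℚ := (x.2 k).choose

theorem coord_eq (x : ErdosSpace) (k : ℕ) : coord x k = ratCoord x k := (x.2 k).choose_spec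

open Classical in
/-- The labels of a point of Erdős space: the comparisons of its coordinates with the elements of
`√2 + ℚ`. -/
noncomputable def label (i : ℕ) (x : ErdosSpace) : ℕ :=
  if coord x i.unpair.1 < √2 + ((Encodable.decode i.unpair.2 : Option ℚ).getD 0 : ℚ) then 1 else 0

/-- The `k`-th rank of a point of Erdős space. -/
noncomputable def rank (k : ℕ) (x : ErdosSpace) : ℕ := Encodable.encode (ratCoord x k)

theorem comap_label (x : ErdosSpace) :
    comap (fun y i => label i y) (𝓝 fun i => label i x) = comap coord (𝓝 (coord x)) := by
  refine le_antisymm (map_le_iff_le_comap.1 (tendsto_pi_nhds.2 fun k => ?_))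
    (map_le_iff_le_comap.1 (tendsto_pi_nhds.2 fun i => ?_))
  · have key : ∀ q : ℚ, ∀ᶠ y in comap (fun y i => label i y) (𝓝 fun i => label i x),
        (coord x k < √2 + q ↔ coord y k < √2 + q) := by
      intro q
      have ht : Tendsto (fun y i => label i y) (comap (fun y i => label i y)
        (𝓝 fun i => label i x)) (𝓝 fun i => label i x) := tendsto_comap
      have := (tendsto_pi_nhds.1 ht (Nat.pair k (Encodable.encode q))).eventually_mem
        ((isOpen_discrete {label (Nat.pair k (Encodable.encode q)) x}).mem_nhds rfl)
      filter_upwards [this] with y hy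
      simp only [label, Nat.unpair_pair, Encodable.encodek, Option.getD_some, mem_singleton_iff] at hy
      split_ifs at hy with h1 h2 h2 <;> tauto
    refine tendsto_order.2 ⟨fun a ha => ?_, fun a ha => ?_⟩
    · obtain ⟨q, hq, hq'⟩ := exists_rat_btwn (sub_lt_sub_right ha √2)
      filter_upwards [key q] with y hy
      by_contra! h
      linarith [hy.2 (by linarith)]
    · obtain ⟨q, hq, hq'⟩ := exists_rat_btwn (sub_lt_sub_right ha √2)
      filter_upwards [key q] with y hy
      linarith [hy.1 (by linarith)]
  · refine tendsto_nhds_of_eventually_eq ?_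
    have hc : Tendsto coord (comap coord (𝓝 (coord x))) (𝓝 (coord x)) := tendsto_comap
    have ht := tendsto_pi_nhds.1 hc i.unpair.1
    rcases lt_trichotomy (coord x i.unpair.1) (√2 + ((Encodable.decode i.unpair.2 : Option ℚ).getD 0 : ℚ))
      with h | h | h
    · filter_upwards [ht.eventually (gt_mem_nhds h)] with y hy
      rw [label, label, if_pos h, if_pos hy]
    · rw [coord_eq] at h
      exact ((irrational_sqrt_two.add_ratCast _).ne_rat _ h.symm).elim
    · filter_upwards [ht.eventually (lt_mem_nhds h)] with y hy
      rw [label, label, if_neg h.not_gt, if_neg hy.not_gt]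

theorem hasBasis_coord (x : ErdosSpace) :
    (comap coord (𝓝 (coord x))).HasBasis (fun _ : ℕ => True) fun m => {y | Near label m x y} := by
  rw [← comap_label]
  exact Near.hasBasis label x

theorem exists_near_imp {x : ErdosSpace} {p : (ℕ → ℝ) → Prop} (h : ∀ᶠ z in 𝓝 (coord x), p z) :
    ∃ m, ∀ y, Near label m x y → p (coord y) := by
  obtain ⟨m, _, hm⟩ := (hasBasis_coord x).mem_iff.1 (preimage_mem_comap h)
  exact ⟨m, fun y hy => hm hy⟩

theorem continuous_coord : Continuous coord :=
  continuous_pi fun k =>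
    (lp.lipschitzWith_one_eval (E := fun _ : ℕ => ℝ) 2 k).continuous.comp continuous_subtype_val

theorem hasSum_sq (x : ErdosSpace) : HasSum (fun k => coord x k ^ 2) (‖x.1‖ ^ 2) := by
  have := lp.hasSum_norm (p := 2) (by norm_num) x.1
  simpa [coord] using this

theorem nhds_eq (x : ErdosSpace) : 𝓝 x = comap coord (𝓝 (coord x)) ⊓
    comap (fun y : ErdosSpace => ‖y.1‖ ^ 2) (𝓝 (‖x.1‖ ^ 2)) := by
  refine le_antisymm (le_inf (map_le_iff_le_comap.1 continuous_coord.continuousAt)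
    (map_le_iff_le_comap.1 (continuous_subtype_val.norm.pow 2).continuousAt)) ?_
  set l := comap coord (𝓝 (coord x)) ⊓
    comap (fun y : ErdosSpace => ‖y.1‖ ^ 2) (𝓝 (‖x.1‖ ^ 2))
  have hc : ∀ k, Tendsto (fun y => coord y k) l (𝓝 (coord x k)) :=
    tendsto_pi_nhds.1 ((tendsto_comap (f := coord)).mono_left inf_le_left)
  have hn : Tendsto (fun y : ErdosSpace => ‖y.1‖ ^ 2) l (𝓝 (‖x.1‖ ^ 2)) :=
    tendsto_comap.mono_left inf_le_right
  have hsum := lp.hasSum_single (p := 2) (by norm_num) x.1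
  refine Metric.nhds_basis_ball.ge_iff.2 fun ε hε => ?_
  obtain ⟨s, hs⟩ := (hsum.eventually (Metric.ball_mem_nhds x.1 (half_pos hε))).exists
  set z := ∑ i ∈ s, lp.single 2 i (x.1 i)
  have hz : ‖x.1 - z‖ < ε / 2 := by rw [← dist_eq_norm, dist_comm]; exact hs
  have hi : ∀ y : ErdosSpace, ‖y.1 - z‖ ^ 2 =
      ‖y.1‖ ^ 2 - 2 * ∑ i ∈ s, coord y i * coord x i + ‖z‖ ^ 2 := by
    intro y
    rw [norm_sub_sq_real, inner_sum]
    simp only [lp.inner_single_right]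
    simp [coord, mul_comm]
  have ht : Tendsto (fun y : ErdosSpace => ‖y.1 - z‖ ^ 2) l (𝓝 (‖x.1 - z‖ ^ 2)) := by
    simp only [hi]
    exact (hn.sub ((tendsto_finsetSum s fun i _ => (hc i).mul_const _).const_mul 2)).add_const _
  filter_upwards [ht.eventually (gt_mem_nhds (pow_lt_pow_left₀ hz (norm_nonneg _) two_ne_zero))]
    with y hy
  have hy' := lt_of_pow_lt_pow_left₀ 2 (by positivity) hy
  rw [Metric.mem_ball, Subtype.dist_eq, dist_eq_norm]
  calc ‖y.1 - x.1‖ = ‖(y.1 - z) - (x.1 - z)‖ := by congr 1; abel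
    _ ≤ ‖y.1 - z‖ + ‖x.1 - z‖ := norm_sub_le _ _
    _ < ε := by linarith

/-- The point obtained by adding `r` to the `k`-th coordinate. -/
noncomputable def shift (x : ErdosSpace) (k : ℕ) (r : ℚ) : ErdosSpace :=
  ⟨x.1 + lp.single 2 k (r : ℝ), fun n => by
    obtain ⟨q, hq⟩ := x.2 n
    by_cases h : n = k
    · subst h
      exact ⟨q + r, by simp [hq]⟩
    · exact ⟨q, by simp [hq, h]⟩⟩

theorem coord_shift_self (x : ErdosSpace) (k : ℕ) (r : ℚ) :
    coord (shift x k r) k = coord x k + r := by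
  simp [coord, shift]

theorem coord_shift_of_ne (x : ErdosSpace) {k n : ℕ} (r : ℚ) (h : n ≠ k) :
    coord (shift x k r) n = coord x n := by
  simp [coord, shift, h]

theorem norm_shift_sq (x : ErdosSpace) (k : ℕ) (r : ℚ) :
    ‖(shift x k r).1‖ ^ 2 = ‖x.1‖ ^ 2 + 2 * (coord x k * r) + r ^ 2 := by
  rw [shift, norm_add_sq_real, lp.inner_single_right, lp.norm_single (by norm_num)]
  simp [coord, mul_comm, -Rat.norm_cast_real]

theorem rank_eq_iff {x y : ErdosSpace} {k : ℕ} : rank k x = rank k y ↔ coord x k = coord y k := by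
  rw [rank, rank, Encodable.encode_inj, coord_eq, coord_eq, Rat.cast_inj]

theorem near_shift (x : ErdosSpace) {k m : ℕ} (r : ℚ) (h : m ≤ k) :
    Near label m x (shift x k r) := by
  intro i hi
  have : i.unpair.1 ≠ k := ((i.unpair_left_le.trans_lt hi).trans_le h).ne
  rw [label, label, coord_shift_of_ne x r this]

theorem tendsto_coord (x : ErdosSpace) : Tendsto (coord x) atTop (𝓝 0) := by
  have h := (hasSum_sq x).summable.tendsto_atTop_zero
  have := h.sqrt
  simp only [Real.sqrt_sq_eq_abs, Real.sqrt_zero] at this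
  exact (tendsto_zero_iff_abs_tendsto_zero _).2 this

theorem rank_lsc (k : ℕ) (x : ErdosSpace) :
    ∃ n, ∀ y, Near label n x y → rank k x ≤ rank k y := by
  have hfin : {q : ℚ | Encodable.encode q < rank k x}.Finite :=
    (Set.finite_Iio (rank k x)).preimage Encodable.encode_injective.injOn
  have : ∀ᶠ z in 𝓝 (coord x), ∀ q ∈ {q : ℚ | Encodable.encode q < rank k x}, z k ≠ (q : ℝ) := by
    rw [Filter.eventually_all_finite hfin]
    intro q hq
    refine (continuous_apply k).continuousAt.eventually_ne ?_
    intro h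
    rw [coord_eq, Rat.cast_inj] at h
    subst h
    exact (lt_irrefl (rank k x)) hq
  obtain ⟨n, hn⟩ := exists_near_imp this
  refine ⟨n, fun y hy => ?_⟩
  by_contra! h
  exact hn y hy _ h (coord_eq y k)

theorem norm_lsc (x : ErdosSpace) {ε : ℝ} (hε : 0 < ε) :
    ∃ n, ∀ y, Near label n x y → ‖x.1‖ ^ 2 - ε < ‖y.1‖ ^ 2 := by
  obtain ⟨s, hs⟩ := ((hasSum_sq x).eventually (lt_mem_nhds (sub_lt_self _ hε))).exists
  have hc : Continuous fun z : ℕ → ℝ => ∑ k ∈ s, z k ^ 2 := by fun_prop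
  obtain ⟨n, hn⟩ := exists_near_imp (hc.continuousAt.eventually (lt_mem_nhds hs))
  exact ⟨n, fun y hy => (hn y hy).trans_le
    (sum_le_hasSum s (fun _ _ => sq_nonneg _) (hasSum_sq y))⟩

theorem exists_limit (s : ℕ → ErdosSpace) (hM : ∃ M, ∀ n, ‖(s n).1‖ ^ 2 ≤ M)
    (hs : ∀ k, ∃ a, ∀ᶠ n in atTop, rank k (s n) = a) :
    ∃ x, ∀ m, ∀ᶠ n in atTop, Near label m x (s n) := by
  obtain ⟨M, hM⟩ := hM
  have : ∀ k, ∃ q : ℚ, ∀ᶠ n in atTop, coord (s n) k = q := by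
    intro k
    obtain ⟨a, ha⟩ := hs k
    obtain ⟨N, hN⟩ := ha.exists
    refine ⟨ratCoord (s N) k, ha.mono fun n hn => ?_⟩
    rw [← coord_eq, ← rank_eq_iff, hn, hN]
  choose t ht using this
  have hmem : Memℓp (fun k => (t k : ℝ)) 2 := by
    refine memℓp_gen' (C := M) fun S => ?_
    obtain ⟨n, hn⟩ := ((Filter.eventually_all_finset S).2 fun k _ => ht k).exists
    calc ∑ k ∈ S, ‖(t k : ℝ)‖ ^ (2 : ENNReal).toReal = ∑ k ∈ S, coord (s n) k ^ 2 := by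
          refine Finset.sum_congr rfl fun k hk => ?_
          rw [hn k hk]
          simp [-Rat.norm_cast_real]
      _ ≤ _ := (sum_le_hasSum S (fun _ _ => sq_nonneg _) (hasSum_sq (s n))).trans (hM n)
  refine ⟨⟨⟨_, hmem⟩, fun k => ⟨t k, rfl⟩⟩, fun m => ?_⟩
  set x : ErdosSpace := ⟨⟨_, hmem⟩, fun k => ⟨t k, rfl⟩⟩
  have hlim : Tendsto (fun n => coord (s n)) atTop (𝓝 (coord x)) :=
    tendsto_pi_nhds.2 fun k => tendsto_nhds_of_eventually_eq (ht k)
  exact (tendsto_comap_iff.2 hlim).eventually ((hasBasis_coord x).mem_of_mem trivial)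

theorem exists_raise (p : ErdosSpace) (j m : ℕ) {δ : ℝ} (hδ : 0 ≤ δ) {ε : ℝ} (hε : 0 < ε) :
    ∃ q, Near label m p q ∧ (∀ k < j, rank k q = rank k p) ∧ rank j q ≠ rank j p ∧
      |‖q.1‖ ^ 2 - ‖p.1‖ ^ 2 - δ| < ε := by
  obtain ⟨r, hr, hr'⟩ := exists_rat_btwn (Real.sqrt_lt_sqrt hδ (lt_add_of_pos_right δ hε))
  have hr1 : δ < (r : ℝ) ^ 2 := (Real.sqrt_lt' ((Real.sqrt_nonneg _).trans_lt hr)).1 hr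
  have hr2 : (r : ℝ) ^ 2 < δ + ε := (Real.lt_sqrt ((Real.sqrt_nonneg _).trans hr.le)).1 hr'
  have ht : Tendsto (fun N => ‖(shift p N r).1‖ ^ 2 - ‖p.1‖ ^ 2 - δ) atTop
      (𝓝 ((r : ℝ) ^ 2 - δ)) := by
    have := (((tendsto_coord p).mul_const (r : ℝ)).const_mul 2).add_const ((r : ℝ) ^ 2 - δ)
    rw [zero_mul, mul_zero, zero_add] at this
    refine this.congr fun N => ?_
    rw [norm_shift_sq]
    ring
  have habs : |(r : ℝ) ^ 2 - δ| < ε := by rw [abs_lt]; constructor <;> linarith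
  obtain ⟨N, hN, hN'⟩ := ((ht.abs.eventually (gt_mem_nhds habs)).and
    (eventually_ge_atTop (max m (j + 1)))).exists
  have hjN : j ≠ N := by
    have := (le_max_right m (j + 1)).trans hN'
    omega
  have hnear := near_shift p r ((le_max_left _ _).trans hN')
  set w := shift p N r
  have htend : Tendsto (fun i : ℕ => shift w j (1 / ((i : ℚ) + 1))) atTop (𝓝 w) := by
    rw [tendsto_subtype_rng]
    have h0 : Tendsto (fun i : ℕ => (((1 / ((i : ℚ) + 1) : ℚ)) : ℝ)) atTop (𝓝 0) := by
      simpa using tendsto_one_div_add_atTop_nhds_zero_nat (𝕜 := ℝ)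
    have h1 := ((lp.isometry_single (E := fun _ : ℕ => ℝ) (p := 2) j).continuous.tendsto 0).comp h0
    rw [lp.single_zero] at h1
    simpa [shift] using h1.const_add w.1
  have hw : ∀ᶠ y in 𝓝 w, Near label m w y := by
    rw [nhds_eq]
    exact mem_inf_of_left ((hasBasis_coord w).mem_of_mem trivial)
  have hφ : ∀ᶠ y : ErdosSpace in 𝓝 w, |‖y.1‖ ^ 2 - ‖p.1‖ ^ 2 - δ| < ε := by
    have : Continuous fun y : ErdosSpace => |‖y.1‖ ^ 2 - ‖p.1‖ ^ 2 - δ| := by fun_prop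
    exact this.continuousAt.eventually (gt_mem_nhds hN)
  obtain ⟨i, hi, hi'⟩ := (htend.eventually (hw.and hφ)).exists
  refine ⟨_, hnear.trans hi, fun k hk => ?_, ?_, hi'⟩
  · rw [rank_eq_iff, coord_shift_of_ne _ _ hk.ne, coord_shift_of_ne _ _ (by omega)]
  · rw [Ne, rank_eq_iff, coord_shift_self, coord_shift_of_ne _ _ hjN]
    have : ((1 / ((i : ℚ) + 1) : ℚ) : ℝ) ≠ 0 := by
      rw [Rat.cast_ne_zero]
      positivity
    simpa using this

theorem exists_spread (p : ErdosSpace) (n m : ℕ) {ε : ℝ} (hε : 0 < ε) :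
    ∃ g : ErdosSpace → ℕ, (∀ x, ∃ r, ∀ y, Near label r x y → g y = g x) ∧
      ∀ M, ∃ x, Near label m p x ∧ (∀ k < n, rank k x = rank k p) ∧
        ‖x.1‖ ^ 2 < ‖p.1‖ ^ 2 + ε ∧ M ≤ g x := by
  obtain ⟨δ, hδ0, hδ1, hδε⟩ : ∃ δ : ℝ, 0 < δ ∧ δ ≤ 1 ∧ 4 * δ ≤ ε :=
    ⟨min 1 (ε / 4), by positivity, min_le_left _ _, by linarith [min_le_right 1 (ε / 4)]⟩
  obtain ⟨ρ, hρ, hρ0, hρδ⟩ := exists_irrational_btwn hδ0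
  obtain ⟨N, hN, hN'⟩ := (((tendsto_coord p).abs.eventually
    (gt_mem_nhds (by rw [abs_zero]; exact one_pos))).and
    (eventually_ge_atTop (max n m))).exists
  refine ⟨fun x => ⌊1 / |coord x N - coord p N - ρ|⌋₊, fun x => ?_, fun M => ?_⟩
  · obtain ⟨q, hq⟩ : ∃ q : ℚ, coord x N - coord p N - ρ = q - ρ :=
      ⟨ratCoord x N - ratCoord p N, by rw [coord_eq, coord_eq]; push_cast; ring⟩
    have hirr : Irrational (1 / |coord x N - coord p N - ρ|) := by
      rw [hq, one_div, irrational_inv_iff]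
      rcases abs_choice ((q : ℝ) - ρ) with h | h <;> rw [h]
      · exact hρ.ratCast_sub q
      · exact (hρ.ratCast_sub q).neg
    have hne : |coord x N - coord p N - ρ| ≠ 0 := by
      intro h
      rw [h] at hirr
      exact hirr.ne_zero (by simp)
    have hcont : ContinuousAt (fun z : ℕ → ℝ => 1 / |z N - coord p N - ρ|) (coord x) :=
      ContinuousAt.div continuousAt_const (Continuous.continuousAt (by fun_prop)) hne
    have hlt : (⌊1 / |coord x N - coord p N - ρ|⌋₊ : ℝ) < 1 / |coord x N - coord p N - ρ| :=
      lt_of_le_of_ne (Nat.floor_le (by positivity)) (hirr.ne_nat _).symm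
    obtain ⟨r, hr⟩ := exists_near_imp ((hcont.eventually (lt_mem_nhds hlt)).and
      (hcont.eventually (gt_mem_nhds (Nat.lt_floor_add_one _))))
    exact ⟨r, fun y hy => (Nat.floor_eq_iff (by positivity)).2
      ⟨(hr y hy).1.le, (hr y hy).2⟩⟩
  · obtain ⟨r, hr, hr'⟩ := exists_rat_btwn
      (lt_min hρδ (lt_add_of_pos_right ρ (by positivity : (0 : ℝ) < 1 / (M + 1))))
    rw [lt_min_iff] at hr'
    have hnN := (le_max_left n m).trans hN'
    refine ⟨shift p N r, near_shift p r ((le_max_right _ _).trans hN'), fun k hk => ?_, ?_, ?_⟩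
    · rw [rank_eq_iff, coord_shift_of_ne _ _ (by omega)]
    · rw [norm_shift_sq]
      have h1 := abs_lt.1 hN
      nlinarith
    · refine Nat.le_floor ?_
      rw [coord_shift_self, abs_of_pos (by linarith), le_div_iff₀ (by linarith)]
      have : ((M : ℝ) + 1) * (1 / (M + 1)) = 1 := by field_simp
      have hM : (0 : ℝ) ≤ M := M.cast_nonneg
      nlinarith

/-- Erdős space is presented by the rational approximations of the coordinates and the norm. -/
noncomputable def presentation : ErdosPresentation ErdosSpace where
  u := label
  L := rank
  φ x := ‖x.1‖ ^ 2
  φ_nonneg _ := by positivity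
  isInducing := isInducing_iff_nhds.2 fun x => by
    rw [nhds_prod_eq, Filter.prod_eq_inf, Filter.comap_inf, Filter.comap_comap,
      Filter.comap_comap, nhds_eq, ← comap_label]
    rfl
  ext_label x y h := by
    by_contra hxy
    have hc : coord x ≠ coord y := fun h => hxy (Subtype.ext (lp.ext h))
    obtain ⟨m, hm⟩ := exists_near_imp (eventually_ne_nhds hc)
    exact hm y (fun i _ => h i) rfl
  L_lsc := rank_lsc
  φ_lsc x _ hε := norm_lsc x hε
  exists_cluster s hM hs := (exists_limit s hM hs).imp fun _ h m => (h m).frequently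
  exists_raise p j m _ hδ _ hε := exists_raise p j m hδ hε
  exists_spread p n m _ hε := exists_spread p n m hε

end ErdosSpace

open scoped NNReal

theorem tendsto_tsum_geometric {Y : Type*} {l : Filter Y} {f : ℕ → Y → ℝ} {c : ℕ → ℝ} {K : ℝ}
    (hf : ∀ i, Tendsto (f i) l (𝓝 (c i))) (hK : ∀ᶠ y in l, ∀ i, |f i y| ≤ K) :
    Tendsto (fun y => ∑' i, (1 / 2) ^ i * f i y) l (𝓝 (∑' i, (1 / 2) ^ i * c i)) := by
  refine tendsto_tsum_of_dominated_convergence (bound := fun i => (1 / 2 : ℝ) ^ i * K)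
    (summable_geometric_two.mul_right K) (fun i => (hf i).const_mul _) ?_
  filter_upwards [hK] with y hy i
  rw [norm_mul, norm_pow, Real.norm_eq_abs (f i y)]
  gcongr
  · norm_num
  · exact hy i

theorem eventually_sub_lt_of_hasSum {Y : Type*} {l : Filter Y} {f : ℕ → Y → ℝ} {F : Y → ℝ}
    {c : ℕ → ℝ} {C : ℝ} (hf : ∀ i y, 0 ≤ f i y) (hF : ∀ y, HasSum (fun i => f i y) (F y))
    (hc : HasSum c C) (hl : ∀ i, ∀ ε > 0, ∀ᶠ y in l, c i - ε < f i y) {ε : ℝ} (hε : 0 < ε) :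
    ∀ᶠ y in l, C - ε < F y := by
  obtain ⟨s, hs⟩ := (hc.eventually (lt_mem_nhds (sub_lt_self C (half_pos hε)))).exists
  have : ∀ᶠ y in l, ∀ i ∈ s, c i - ε / 2 / (s.card + 1) < f i y :=
    (Filter.eventually_all_finset s).2 fun i _ => hl i _ (by positivity)
  filter_upwards [this] with y hy
  have h1 := sum_le_hasSum s (fun i _ => hf i y) (hF y)
  have h2 := Finset.sum_le_sum fun i hi => (hy i hi).le
  rw [Finset.sum_sub_distrib, Finset.sum_const, nsmul_eq_mul] at h2
  have h3 : (s.card : ℝ) * (ε / 2 / (s.card + 1)) ≤ ε / 2 := by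
    rw [← mul_div_assoc, div_le_iff₀ (by positivity)]
    nlinarith [(Nat.cast_nonneg s.card : (0 : ℝ) ≤ s.card)]
  linarith

theorem eventually_lt_add_of_hasSum {Y : Type*} {l : Filter Y} {f : ℕ → Y → ℝ} {F : Y → ℝ}
    {c : ℕ → ℝ} {C : ℝ} (hf : ∀ i y, 0 ≤ f i y) (hF : ∀ y, HasSum (fun i => f i y) (F y))
    (hc : HasSum c C) (hl : ∀ i, ∀ ε > 0, ∀ᶠ y in l, c i - ε < f i y)
    (hl' : ∀ ε > 0, ∀ᶠ y in l, F y < C + ε) (i : ℕ) {ε : ℝ} (hε : 0 < ε) :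
    ∀ᶠ y in l, f i y < c i + ε := by
  have := eventually_sub_lt_of_hasSum (l := l) (f := fun j y => if j = i then 0 else f j y)
    (F := fun y => F y - f i y) (c := fun j => if j = i then 0 else c j) (C := C - c i)
    (fun j y => by split_ifs; exacts [le_rfl, hf j y])
    (fun y => by simpa using hasSum_ite_sub_hasSum (hF y) i)
    (by simpa using hasSum_ite_sub_hasSum hc i)
    (fun j ε hε => by
      by_cases h : j = i
      · simp [h, hε]
      · simpa [h] using hl j ε hε) (half_pos hε)
  filter_upwards [this, hl' _ (half_pos hε)] with y h1 h2
  linarith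

namespace FinHyp

variable {X : Type*}

/-- The underlying finset. -/
noncomputable def toFinset (A : FinHyp X) : Finset X := A.2.1.toFinset

@[simp] theorem mem_toFinset {A : FinHyp X} {a : X} : a ∈ A.toFinset ↔ a ∈ A.1 :=
  A.2.1.mem_toFinset

theorem nonempty_toFinset (A : FinHyp X) : A.toFinset.Nonempty :=
  A.2.1.toFinset_nonempty.2 A.2.2

/-- The point of the hyperspace given by a finset. -/
def ofFinset (S : Finset X) (h : S.Nonempty) : FinHyp X := ⟨S, S.finite_toSet, h⟩

@[simp] theorem toFinset_ofFinset (S : Finset X) (h : S.Nonempty) :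
    (ofFinset S h).toFinset = S := by
  ext
  rw [mem_toFinset]
  exact Finset.mem_coe

theorem eventually_subset [TopologicalSpace X] {A : FinHyp X} {U : Set X} (hU : IsOpen U)
    (h : A.1 ⊆ U) : ∀ᶠ B : FinHyp X in 𝓝 A, B.1 ⊆ U := by
  have : IsOpen {B : FinHyp X | B.1 ⊆ U} :=
    ⟨{F | F ⊆ U}, TopologicalSpace.isOpen_generateFrom_of_mem (Or.inl ⟨U, hU, rfl⟩), rfl⟩
  exact this.mem_nhds h

theorem eventually_inter_nonempty [TopologicalSpace X] {A : FinHyp X} {U : Set X} (hU : IsOpen U)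
    (h : (A.1 ∩ U).Nonempty) : ∀ᶠ B : FinHyp X in 𝓝 A, (B.1 ∩ U).Nonempty := by
  have : IsOpen {B : FinHyp X | (B.1 ∩ U).Nonempty} :=
    ⟨{F | (F ∩ U).Nonempty}, TopologicalSpace.isOpen_generateFrom_of_mem (Or.inr ⟨U, hU, rfl⟩), rfl⟩
  exact this.mem_nhds h

theorem le_nhds [TopologicalSpace X] {A : FinHyp X} {l : Filter (FinHyp X)}
    (h1 : ∀ U, IsOpen U → A.1 ⊆ U → ∀ᶠ B in l, B.1 ⊆ U)
    (h2 : ∀ U, IsOpen U → (A.1 ∩ U).Nonempty → ∀ᶠ B in l, (B.1 ∩ U).Nonempty) : l ≤ 𝓝 A := by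
  rw [@nhds_induced _ _ (vietoris _), ← map_le_iff_le_comap]
  unfold vietoris
  rw [TopologicalSpace.nhds_generateFrom]
  refine le_iInf₂ fun S hS => ?_
  rw [le_principal_iff, mem_map]
  obtain ⟨hA, ⟨U, hU, rfl⟩ | ⟨U, hU, rfl⟩⟩ := hS
  · exact h1 U hU hA
  · exact h2 U hU hA

/-- `A` and `B` meet the same balls of labels of length `n`. -/
def Close (u : ℕ → X → ℕ) (n : ℕ) (A B : FinHyp X) : Prop :=
  (∀ a ∈ A.1, ∃ b ∈ B.1, Near u n a b) ∧ ∀ b ∈ B.1, ∃ a ∈ A.1, Near u n a b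

theorem Close.mono {u : ℕ → X → ℕ} {m n : ℕ} {A B : FinHyp X} (hmn : m ≤ n) (h : Close u n A B) :
    Close u m A B :=
  ⟨fun a ha => (h.1 a ha).imp fun _ h => ⟨h.1, h.2.mono hmn⟩,
    fun b hb => (h.2 b hb).imp fun _ h => ⟨h.1, h.2.mono hmn⟩⟩

/-- The first `n` labels of a point. -/
def word (u : ℕ → X → ℕ) (n : ℕ) (a : X) : List ℕ := (List.range n).map fun i => u i a

theorem word_eq_iff {u : ℕ → X → ℕ} {n : ℕ} {a b : X} : word u n a = word u n b ↔ Near u n a b := by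
  simp [word, List.map_inj_left, Near]

/-- The labels of a finite set: the labels of its elements. -/
noncomputable def label (u : ℕ → X → ℕ) (n : ℕ) (A : FinHyp X) : ℕ :=
  Encodable.encode (A.toFinset.image (word u n))

theorem label_eq_iff {u : ℕ → X → ℕ} {n : ℕ} {A B : FinHyp X} :
    label u n A = label u n B ↔ Close u n A B := by
  rw [label, label, Encodable.encode_inj, Close, Finset.Subset.antisymm_iff]
  refine and_congr ?_ ?_
  · simp only [Finset.image_subset_iff, Finset.mem_image, mem_toFinset, word_eq_iff]
    exact forall₂_congr fun a _ => exists_congr fun b => and_congr_right fun _ =>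
      ⟨Near.symm, Near.symm⟩
  · simp only [Finset.image_subset_iff, Finset.mem_image, mem_toFinset, word_eq_iff]

theorem near_label_succ_iff {u : ℕ → X → ℕ} {n : ℕ} {A B : FinHyp X} :
    Near (label u) (n + 1) A B ↔ Close u n A B :=
  ⟨fun h => label_eq_iff.1 (h n (Nat.lt_succ_self n)),
    fun h _ hi => label_eq_iff.2 (h.mono (Nat.lt_succ_iff.1 hi))⟩

theorem hasBasis_close (u : ℕ → X → ℕ) (A : FinHyp X) :
    (comap (fun B i => label u i B) (𝓝 fun i => label u i A)).HasBasis (fun _ : ℕ => True)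
      fun n => {B | Close u n A B} := by
  refine (Near.hasBasis (label u) A).to_hasBasis (fun n _ => ⟨n, trivial, fun B hB => ?_⟩)
    fun n _ => ⟨n + 1, trivial, fun B hB => near_label_succ_iff.1 hB⟩
  exact (near_label_succ_iff.2 hB).mono (Nat.le_succ n)

theorem exists_near_imp {u : ℕ → X → ℕ} {A : FinHyp X} {p : FinHyp X → Prop}
    (h : ∃ n, ∀ B, Close u n A B → p B) : ∃ n, ∀ B, Near (label u) n A B → p B :=
  h.imp' (· + 1) fun _ h B hB => h B (near_label_succ_iff.1 hB)

theorem exists_enumeration (A : FinHyp X) (N : ℕ) :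
    ∃ x : Fin N → X, (∀ c, x c ∈ A.1) ∧ (A.toFinset.card = N → A.1 ⊆ range x) := by
  by_cases h : A.toFinset.card = N
  · refine ⟨fun c => (A.toFinset.equivFinOfCardEq h).symm c,
      fun c => mem_toFinset.1 (Subtype.prop _), fun _ a ha =>
      ⟨A.toFinset.equivFinOfCardEq h ⟨a, mem_toFinset.2 ha⟩, by simp⟩⟩
  · obtain ⟨a, ha⟩ := A.2.2
    exact ⟨fun _ => a, fun _ => ha, fun h' => (h h').elim⟩

end FinHyp

namespace ErdosPresentation

variable {X : Type*} [TopologicalSpace X] (P : ErdosPresentation X)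

theorem isOpen_near (m : ℕ) (x : X) : IsOpen {y | Near P.u m x y} := by
  refine isOpen_iff_mem_nhds.2 fun y hy => ?_
  filter_upwards [(P.hasBasis_nhds y).mem_of_mem (i := (m, 1)) one_pos] with z hz
  exact Near.trans hy hz.1

theorem continuous_φ : Continuous P.φ := continuous_snd.comp P.isInducing.continuous

/-- Membership in the `i`-th ball of labels, in an enumeration of all these balls. -/
def Cyl (i : ℕ) (a : X) : Prop :=
  FinHyp.word P.u ((Encodable.decode i : Option (List ℕ)).getD []).length a =
    (Encodable.decode i : Option (List ℕ)).getD []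

theorem cyl_congr (i : ℕ) : ∃ n, ∀ a b, Near P.u n a b → (P.Cyl i a ↔ P.Cyl i b) :=
  ⟨_, fun a b h => by rw [Cyl, Cyl, FinHyp.word_eq_iff.2 h]⟩

theorem exists_cyl (n : ℕ) (a : X) : ∃ i, ∀ b, P.Cyl i b ↔ Near P.u n a b := by
  refine ⟨Encodable.encode (FinHyp.word P.u n a), fun b => ?_⟩
  have : (FinHyp.word P.u n a).length = n := by simp [FinHyp.word]
  rw [Cyl, Encodable.encodek, Option.getD_some, this, FinHyp.word_eq_iff]
  exact ⟨Near.symm, Near.symm⟩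

theorem exists_cyl_univ : ∃ i, ∀ a, P.Cyl i a := by
  refine ⟨Encodable.encode ([] : List ℕ), fun a => ?_⟩
  rw [Cyl, Encodable.encodek]
  simp [FinHyp.word]

open Classical in
/-- The function `φ`, cut off outside of the `i`-th ball. -/
noncomputable def weight (i : ℕ) (a : X) : ℝ≥0 := if P.Cyl i a then (P.φ a).toNNReal else 0

theorem weight_of_cyl {i : ℕ} {a : X} (h : P.Cyl i a) : (P.weight i a : ℝ) = P.φ a := by
  rw [weight, if_pos h, Real.coe_toNNReal _ (P.φ_nonneg a)]

theorem weight_of_not_cyl {i : ℕ} {a : X} (h : ¬ P.Cyl i a) : P.weight i a = 0 := if_neg h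

theorem weight_le (i : ℕ) (a : X) : P.weight i a ≤ (P.φ a).toNNReal := by
  rw [weight]
  split_ifs
  exacts [le_rfl, zero_le]

/-- The largest weight of an element of a finite set. -/
noncomputable def peak (i : ℕ) (S : Finset X) : ℝ≥0 := S.sup (P.weight i)

theorem peak_le_of_cyl {i : ℕ} (h : ∀ a, P.Cyl i a) (j : ℕ) (S : Finset X) :
    P.peak j S ≤ P.peak i S :=
  Finset.sup_mono_fun fun a _ => by
    rw [← NNReal.coe_le_coe, P.weight_of_cyl (h a)]
    exact (NNReal.coe_le_coe.2 (P.weight_le j a)).trans_eq (Real.coe_toNNReal _ (P.φ_nonneg a))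

theorem le_peak {i : ℕ} {S : Finset X} {a : X} (ha : a ∈ S) (h : P.Cyl i a) :
    P.φ a ≤ P.peak i S := by
  rw [← P.weight_of_cyl h]
  exact NNReal.coe_le_coe.2 (Finset.le_sup ha)

theorem summable_peak (S : Finset X) :
    Summable fun i => (1 / 2 : ℝ) ^ i * (P.peak i S : ℝ) := by
  obtain ⟨j, hj⟩ := P.exists_cyl_univ
  refine Summable.of_nonneg_of_le (fun i => by positivity) (fun i => ?_)
    (summable_geometric_two.mul_right (P.peak j S : ℝ))
  gcongr
  exact P.peak_le_of_cyl hj i S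

/-- The height of a finite set. -/
noncomputable def height (S : Finset X) : ℝ := ∑' i, (1 / 2) ^ i * (P.peak i S : ℝ)

theorem hasSum_height (S : Finset X) :
    HasSum (fun i => (1 / 2) ^ i * (P.peak i S : ℝ)) (P.height S) :=
  (P.summable_peak S).hasSum

theorem height_nonneg (S : Finset X) : 0 ≤ P.height S :=
  tsum_nonneg fun _ => by positivity

theorem exists_le_height : ∃ K > 0, ∀ S, ∀ a ∈ S, P.φ a ≤ K * P.height S := by
  obtain ⟨j, hj⟩ := P.exists_cyl_univ
  refine ⟨2 ^ j, by positivity, fun S a ha => (P.le_peak ha (hj a)).trans ?_⟩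
  have h1 := (P.summable_peak S).le_tsum j fun _ _ => by positivity
  calc (P.peak j S : ℝ) = 2 ^ j * ((1 / 2) ^ j * P.peak j S) := by
        rw [← mul_assoc, ← mul_pow]; norm_num
    _ ≤ 2 ^ j * P.height S := by gcongr; exact h1

theorem peak_lsc (i : ℕ) (A : FinHyp X) {ε : ℝ} (hε : 0 < ε) :
    ∃ n, ∀ B, FinHyp.Close P.u n A B → (P.peak i A.toFinset : ℝ) - ε < P.peak i B.toFinset := by
  obtain ⟨a, ha, hmax⟩ := Finset.exists_mem_eq_sup _ A.nonempty_toFinset (P.weight i)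
  have hle : ∀ {B : FinHyp X} {b : X}, b ∈ B.1 → (P.weight i b : ℝ) ≤ P.peak i B.toFinset :=
    fun hb => NNReal.coe_le_coe.2 (Finset.le_sup (FinHyp.mem_toFinset.2 hb))
  rw [peak, hmax]
  by_cases h : P.Cyl i a
  · obtain ⟨n, hn⟩ := P.cyl_congr i
    obtain ⟨r, hr⟩ := P.φ_lsc a ε hε
    refine ⟨max n r, fun B hB => ?_⟩
    obtain ⟨b, hb, hab⟩ := hB.1 a (FinHyp.mem_toFinset.1 ha)
    refine lt_of_lt_of_le ?_ (hle hb)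
    rw [P.weight_of_cyl h, P.weight_of_cyl ((hn a b (hab.mono (le_max_left _ _))).1 h)]
    exact hr b (hab.mono (le_max_right _ _))
  · refine ⟨0, fun B _ => ?_⟩
    rw [P.weight_of_not_cyl h, NNReal.coe_zero, zero_sub]
    exact (neg_neg_of_pos hε).trans_le (by positivity)

theorem eventually_lt_peak (i : ℕ) (A : FinHyp X) {ε : ℝ} (hε : 0 < ε) :
    ∀ᶠ B in comap (fun B i => FinHyp.label P.u i B) (𝓝 fun i => FinHyp.label P.u i A),
      (1 / 2) ^ i * (P.peak i A.toFinset : ℝ) - ε < (1 / 2) ^ i * P.peak i B.toFinset := by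
  obtain ⟨n, hn⟩ := P.peak_lsc i A hε
  filter_upwards [(FinHyp.hasBasis_close P.u A).mem_of_mem (i := n) trivial] with B hB
  have h1 : ((1 : ℝ) / 2) ^ i ≤ 1 := pow_le_one₀ (by norm_num) (by norm_num)
  have h2 : (0 : ℝ) < (1 / 2) ^ i := by positivity
  nlinarith [hn B hB]

theorem height_lsc (A : FinHyp X) {ε : ℝ} (hε : 0 < ε) :
    ∃ n, ∀ B, FinHyp.Close P.u n A B → P.height A.toFinset - ε < P.height B.toFinset := by
  have := eventually_sub_lt_of_hasSum
    (l := comap (fun B i => FinHyp.label P.u i B) (𝓝 fun i => FinHyp.label P.u i A))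
    (f := fun i B => (1 / 2) ^ i * (P.peak i B.toFinset : ℝ))
    (fun i B => by positivity) (fun B => P.hasSum_height B.toFinset) (P.hasSum_height A.toFinset)
    (fun i ε hε => P.eventually_lt_peak i A hε) hε
  obtain ⟨n, _, hn⟩ := (FinHyp.hasBasis_close P.u A).mem_iff.1 this
  exact ⟨n, fun B hB => hn hB⟩

theorem exists_separating_finset (S : Finset X) (a : X) :
    ∃ n, ∀ b ∈ S, Near P.u n a b → b = a := by
  have : ∀ b, ∃ n, Near P.u n a b → b = a := by
    intro b
    by_contra! h
    exact (h 0).2 (P.ext_label a b fun i => (h (i + 1)).1 i (Nat.lt_succ_self i)).symm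
  choose n hn using this
  exact ⟨S.sup n, fun b hb h => hn b (h.mono (Finset.le_sup hb))⟩

theorem exists_separating_pairs (S : Finset X) :
    ∃ n, ∀ a ∈ S, ∀ b ∈ S, Near P.u n a b → b = a := by
  choose n hn using P.exists_separating_finset S
  exact ⟨S.sup n, fun a ha b hb h => hn a b hb (h.mono (Finset.le_sup ha))⟩

theorem eventually_close (n : ℕ) (A : FinHyp X) : ∀ᶠ B in 𝓝 A, FinHyp.Close P.u n A B := by
  have h1 : ∀ᶠ B : FinHyp X in 𝓝 A, B.1 ⊆ ⋃ a ∈ A.1, {b | Near P.u n a b} :=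
    FinHyp.eventually_subset (isOpen_biUnion fun a _ => P.isOpen_near n a)
      fun a ha => mem_biUnion ha (Near.refl P.u n a)
  have h2 : ∀ᶠ B : FinHyp X in 𝓝 A, ∀ a ∈ A.1, (B.1 ∩ {b | Near P.u n a b}).Nonempty :=
    (Filter.eventually_all_finite A.2.1).2 fun a ha =>
      FinHyp.eventually_inter_nonempty (P.isOpen_near n a) ⟨a, ha, Near.refl P.u n a⟩
  filter_upwards [h1, h2] with B h1 h2
  refine ⟨h2, fun b hb => ?_⟩
  obtain ⟨a, ha, h⟩ := mem_iUnion₂.1 (h1 hb)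
  exact ⟨a, ha, h⟩

theorem nhds_le_comap_label (A : FinHyp X) :
    𝓝 A ≤ comap (fun B i => FinHyp.label P.u i B) (𝓝 fun i => FinHyp.label P.u i A) :=
  (FinHyp.hasBasis_close P.u A).ge_iff.2 fun n _ => P.eventually_close n A

theorem continuous_weight (i : ℕ) : Continuous fun a => (P.weight i a : ℝ) := by
  obtain ⟨n, hn⟩ := P.cyl_congr i
  refine continuous_iff_continuousAt.2 fun a => ?_
  have hnear : ∀ᶠ b in 𝓝 a, Near P.u n a b := (P.isOpen_near n a).mem_nhds (Near.refl P.u n a)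
  by_cases h : P.Cyl i a
  · refine (P.continuous_φ.continuousAt (x := a)).congr ?_
    filter_upwards [hnear] with b hb
    rw [P.weight_of_cyl ((hn a b hb).1 h)]
  · refine (continuousAt_const (y := (0 : ℝ))).congr ?_
    filter_upwards [hnear] with b hb
    rw [P.weight_of_not_cyl fun h' => h ((hn a b hb).2 h'), NNReal.coe_zero]

theorem eventually_peak_lt (i : ℕ) (A : FinHyp X) {ε : ℝ} (hε : 0 < ε) :
    ∀ᶠ B in 𝓝 A, (P.peak i B.toFinset : ℝ) < P.peak i A.toFinset + ε := by
  filter_upwards [FinHyp.eventually_subset (A := A)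
    (isOpen_lt (P.continuous_weight i) (continuous_const (y := (P.peak i A.toFinset : ℝ) + ε)))
    fun a ha => lt_add_of_le_of_pos
      (NNReal.coe_le_coe.2 (Finset.le_sup (FinHyp.mem_toFinset.2 ha))) hε] with B hB
  obtain ⟨b, hb, hmax⟩ := Finset.exists_mem_eq_sup _ B.nonempty_toFinset (P.weight i)
  rw [peak, hmax]
  exact hB (FinHyp.mem_toFinset.1 hb)

theorem continuous_height : Continuous fun A : FinHyp X => P.height A.toFinset := by
  refine continuous_iff_continuousAt.2 fun A => ?_
  obtain ⟨j, hj⟩ := P.exists_cyl_univ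
  refine tendsto_tsum_geometric (K := P.peak j A.toFinset + 1) (fun i => ?_) ?_
  · refine tendsto_order.2 ⟨fun c hc => ?_, fun c hc => ?_⟩
    · obtain ⟨n, hn⟩ := P.peak_lsc i A (sub_pos.2 hc)
      filter_upwards [P.eventually_close n A] with B hB
      simpa using hn B hB
    · filter_upwards [P.eventually_peak_lt i A (sub_pos.2 hc)] with B hB
      simpa using hB
  · filter_upwards [P.eventually_peak_lt j A one_pos] with B hB i
    rw [NNReal.abs_eq]
    exact (NNReal.coe_le_coe.2 (P.peak_le_of_cyl hj i _)).trans hB.le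

theorem finHyp_nhds_eq (A : FinHyp X) :
    𝓝 A = comap (fun B i => FinHyp.label P.u i B) (𝓝 fun i => FinHyp.label P.u i A) ⊓
      comap (fun B : FinHyp X => P.height B.toFinset) (𝓝 (P.height A.toFinset)) := by
  refine le_antisymm (le_inf (P.nhds_le_comap_label A)
    (map_le_iff_le_comap.1 P.continuous_height.continuousAt)) ?_
  set l := comap (fun B i => FinHyp.label P.u i B) (𝓝 fun i => FinHyp.label P.u i A) ⊓
      comap (fun B : FinHyp X => P.height B.toFinset) (𝓝 (P.height A.toFinset))
  have hclose : ∀ n, ∀ᶠ B in l, FinHyp.Close P.u n A B := fun n =>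
    mem_inf_of_left ((FinHyp.hasBasis_close P.u A).mem_of_mem trivial)
  have hheight : Tendsto (fun B : FinHyp X => P.height B.toFinset) l
      (𝓝 (P.height A.toFinset)) := tendsto_comap.mono_left inf_le_right
  have hpeak : ∀ i, ∀ ε > 0, ∀ᶠ B in l,
      (P.peak i B.toFinset : ℝ) < P.peak i A.toFinset + ε := by
    intro i ε hε
    have h2 : (0 : ℝ) < (1 / 2) ^ i := by positivity
    have := eventually_lt_add_of_hasSum (l := l)
      (f := fun i B => (1 / 2) ^ i * (P.peak i B.toFinset : ℝ))
      (fun i B => by positivity) (fun B => P.hasSum_height B.toFinset)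
      (P.hasSum_height A.toFinset)
      (fun i ε hε => (P.eventually_lt_peak i A hε).filter_mono inf_le_left)
      (fun ε hε => hheight.eventually (gt_mem_nhds (lt_add_of_pos_right _ hε))) i
      (mul_pos h2 hε)
    filter_upwards [this] with B hB
    rw [← mul_add] at hB
    exact lt_of_mul_lt_mul_left hB h2.le
  have key : ∀ a ∈ A.1, ∀ V ∈ 𝓝 a, ∃ n, ∀ᶠ B in l, ∀ b ∈ B.1, Near P.u n a b → b ∈ V := by
    intro a ha V hV
    obtain ⟨⟨m, ε⟩, hε, hV⟩ := (P.hasBasis_nhds a).mem_iff.1 hV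
    obtain ⟨n₁, hn₁⟩ := P.φ_lsc a ε hε
    obtain ⟨n₂, hn₂⟩ := P.exists_separating_finset A.toFinset a
    refine ⟨max m (max n₁ n₂), ?_⟩
    obtain ⟨i, hi⟩ := P.exists_cyl (max m (max n₁ n₂)) a
    have hA : (P.peak i A.toFinset : ℝ) ≤ P.φ a := by
      obtain ⟨c, hc, hmax⟩ := Finset.exists_mem_eq_sup _ A.nonempty_toFinset (P.weight i)
      rw [peak, hmax]
      by_cases h : P.Cyl i c
      · rw [P.weight_of_cyl h, hn₂ c hc (((hi c).1 h).mono
          ((le_max_right _ _).trans (le_max_right _ _)))]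
      · rw [P.weight_of_not_cyl h]
        exact P.φ_nonneg a
    filter_upwards [hpeak i ε hε] with B hB b hb hab
    refine hV ⟨hab.mono (le_max_left _ _), abs_lt.2 ⟨?_, ?_⟩⟩
    · linarith [hn₁ b (hab.mono ((le_max_left _ _).trans (le_max_right _ _)))]
    · linarith [P.le_peak (FinHyp.mem_toFinset.2 hb) ((hi b).2 hab)]
  refine FinHyp.le_nhds (fun U hU hAU => ?_) fun U hU ⟨a, ha, haU⟩ => ?_
  · choose! n hn using fun a ha => key a ha U (hU.mem_nhds (hAU ha))
    filter_upwards [hclose (A.toFinset.sup n), (Filter.eventually_all_finite A.2.1).2 hn]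
      with B hB hB' b hb
    obtain ⟨a, ha, hab⟩ := hB.2 b hb
    exact hB' a ha b hb (hab.mono (Finset.le_sup (FinHyp.mem_toFinset.2 ha)))
  · obtain ⟨n, hn⟩ := key a ha U (hU.mem_nhds haU)
    filter_upwards [hclose n, hn] with B hB hB'
    obtain ⟨b, hb, hab⟩ := hB.1 a ha
    exact ⟨b, hb, hB' b hb hab⟩

/-- The ranks of a finite set: its cardinality, and the maxima of the ranks of its elements. -/
noncomputable def finRank : ℕ → FinHyp X → ℕ
  | 0, A => A.toFinset.card
  | k + 1, A => A.toFinset.sup (P.L k)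

theorem finRank_lsc (k : ℕ) (A : FinHyp X) :
    ∃ n, ∀ B, FinHyp.Close P.u n A B → P.finRank k A ≤ P.finRank k B := by
  cases k with
  | zero =>
    obtain ⟨n, hn⟩ := P.exists_separating_pairs A.toFinset
    refine ⟨n, fun B hB => ?_⟩
    choose! f hf hf' using hB.1
    refine Finset.card_le_card_of_injOn f
      (fun a ha => FinHyp.mem_toFinset.2 (hf a (FinHyp.mem_toFinset.1 ha))) ?_
    intro a ha b hb hab
    have h1 := hf' a (FinHyp.mem_toFinset.1 ha)
    rw [hab] at h1
    exact (hn a ha b hb (h1.trans (hf' b (FinHyp.mem_toFinset.1 hb)).symm)).symm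
  | succ k =>
    obtain ⟨a, ha, hmax⟩ := Finset.exists_mem_eq_sup _ A.nonempty_toFinset (P.L k)
    obtain ⟨n, hn⟩ := P.L_lsc k a
    refine ⟨n, fun B hB => ?_⟩
    obtain ⟨b, hb, hab⟩ := hB.1 a (FinHyp.mem_toFinset.1 ha)
    rw [finRank, hmax]
    exact (hn b hab).trans (Finset.le_sup (FinHyp.mem_toFinset.2 hb))

theorem finHyp_ext {A B : FinHyp X} (h : ∀ n, FinHyp.Close P.u n A B) : A = B := by
  refine Subtype.ext (Subset.antisymm (fun a ha => ?_) fun b hb => ?_)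
  · obtain ⟨n, hn⟩ := P.exists_separating_finset B.toFinset a
    obtain ⟨b, hb, hab⟩ := (h n).1 a ha
    rwa [← hn b (FinHyp.mem_toFinset.2 hb) hab]
  · obtain ⟨n, hn⟩ := P.exists_separating_finset A.toFinset b
    obtain ⟨a, ha, hab⟩ := (h n).2 b hb
    rwa [← hn a (FinHyp.mem_toFinset.2 ha) hab.symm]

/-- Every sequence with bounded `φ` and eventually constant ranks converges for the topology
generated by the labels. -/
def HasLimits : Prop :=
  ∀ s : ℕ → X, (∃ M, ∀ n, P.φ (s n) ≤ M) → (∀ k, ∃ a, ∀ᶠ n in atTop, P.L k (s n) = a) →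
    ∃ x, ∀ m, ∀ᶠ n in atTop, Near P.u m x (s n)

theorem exists_finHyp_cluster (hP : P.HasLimits) (s : ℕ → FinHyp X)
    (hM : ∃ M, ∀ n, P.height (s n).toFinset ≤ M)
    (hs : ∀ k, ∃ a, ∀ᶠ n in atTop, P.finRank k (s n) = a) :
    ∃ A, ∀ m, ∃ᶠ n in atTop, FinHyp.Close P.u m A (s n) := by
  choose K hK using hs
  choose x hx hx' using fun n => FinHyp.exists_enumeration (s n) (K 0)
  have hLK : ∀ k, ∀ᶠ n in atTop, ∀ c, P.L k (x n c) ≤ K (k + 1) := by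
    intro k
    filter_upwards [hK (k + 1)] with n hn c
    rw [← hn]
    exact Finset.le_sup (FinHyp.mem_toFinset.2 (hx n c))
  have hcomp : IsCompact (Set.univ.pi fun i : Fin (K 0) × ℕ => Set.Iic (K (i.2 + 1))) :=
    isCompact_univ_pi fun i => (Set.finite_Iic _).isCompact
  obtain ⟨v, -, ψ, hψ, hv⟩ := hcomp.tendsto_subseq
    (x := fun n i => min (P.L i.2 (x n i.1)) (K (i.2 + 1)))
    fun n i _ => Set.mem_Iic.2 (min_le_right _ _)
  have hconst : ∀ c k, ∀ᶠ n in atTop, P.L k (x (ψ n) c) = v (c, k) := by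
    intro c k
    filter_upwards [(tendsto_pi_nhds.1 hv (c, k)).eventually_mem
      ((isOpen_discrete {v (c, k)}).mem_nhds rfl), hψ.tendsto_atTop.eventually (hLK k)]
      with n h1 h2
    have h3 : min (P.L k (x (ψ n) c)) (K (k + 1)) = v (c, k) := h1
    rwa [min_eq_left (h2 c)] at h3
  obtain ⟨C, hC, hC'⟩ := P.exists_le_height
  obtain ⟨M, hM⟩ := hM
  choose y hy using fun c => hP (fun n => x (ψ n) c)
    ⟨C * M, fun n => (hC' _ _ (FinHyp.mem_toFinset.2 (hx (ψ n) c))).trans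
      (mul_le_mul_of_nonneg_left (hM _) hC.le)⟩ fun k => ⟨_, hconst c k⟩
  have hpos : 0 < K 0 := by
    obtain ⟨n, hn⟩ := (hK 0).exists
    rw [← hn]
    exact (s n).nonempty_toFinset.card_pos
  refine ⟨⟨range y, finite_range y, ⟨y ⟨0, hpos⟩, mem_range_self _⟩⟩, fun m =>
    hψ.tendsto_atTop.frequently (Eventually.frequently ?_)⟩
  filter_upwards [eventually_all.2 fun c => hy c m, hψ.tendsto_atTop.eventually (hK 0)] with n h1 h2
  refine ⟨?_, fun b hb => ?_⟩
  · rintro _ ⟨c, rfl⟩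
    exact ⟨_, hx (ψ n) c, h1 c⟩
  · obtain ⟨c, rfl⟩ := hx' (ψ n) h2 hb
    exact ⟨_, mem_range_self c, h1 c⟩

open Classical in
/-- The height of the finite set obtained from `S` by adding a point near `a` at which `φ` is
close to `s`. -/
noncomputable def heightInsert (S : Finset X) (a : X) (s : ℝ) : ℝ :=
  ∑' i, (1 / 2) ^ i * max (if P.Cyl i a then s else 0) (P.peak i S : ℝ)

theorem tendsto_heightInsert (S : Finset X) (a : X) {Y : Type*} {l : Filter Y} {f : ℕ → Y → ℝ}
    {s K : ℝ} (h1 : ∀ i, P.Cyl i a → Tendsto (f i) l (𝓝 s))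
    (h2 : ∀ i, ¬ P.Cyl i a → ∀ᶠ y in l, f i y = 0) (hK : ∀ᶠ y in l, ∀ i, |f i y| ≤ K) :
    Tendsto (fun y => ∑' i, (1 / 2) ^ i * max (f i y) (P.peak i S : ℝ)) l
      (𝓝 (P.heightInsert S a s)) := by
  obtain ⟨j, hj⟩ := P.exists_cyl_univ
  refine tendsto_tsum_geometric (K := max K (P.peak j S)) (fun i => ?_) ?_
  · refine Tendsto.max ?_ tendsto_const_nhds
    split_ifs with h
    · exact h1 i h
    · exact tendsto_nhds_of_eventually_eq (h2 i h)
  · filter_upwards [hK] with y hy i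
    refine (abs_max_le_max_abs_abs).trans (max_le_max (hy i) ?_)
    rw [NNReal.abs_eq]
    exact NNReal.coe_le_coe.2 (P.peak_le_of_cyl hj i S)

theorem le_heightInsert (S : Finset X) (a : X) {j : ℕ} (hj : ∀ b, P.Cyl j b) {s : ℝ}
    (hs : 0 ≤ s) : (1 / 2) ^ j * s ≤ P.heightInsert S a s := by
  classical
  have hnn : ∀ i, 0 ≤ max (if P.Cyl i a then s else 0) (P.peak i S : ℝ) :=
    fun i => le_max_of_le_right NNReal.zero_le_coe
  have hsum : Summable fun i => (1 / 2 : ℝ) ^ i *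
      max (if P.Cyl i a then s else 0) (P.peak i S : ℝ) := by
    refine Summable.of_nonneg_of_le (fun i => mul_nonneg (by positivity) (hnn i)) (fun i => ?_)
      (summable_geometric_two.mul_right (max s (P.peak j S : ℝ)))
    refine mul_le_mul_of_nonneg_left (max_le_max ?_ ?_) (by positivity)
    · split_ifs
      exacts [le_rfl, hs]
    · exact NNReal.coe_le_coe.2 (P.peak_le_of_cyl hj i S)
  refine le_trans ?_ ((hsum.le_tsum j fun i _ => mul_nonneg (by positivity) (hnn i)).trans_eq
    (tsum_congr fun i => by congr))
  rw [if_pos (hj a)]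
  gcongr
  exact le_max_left _ _

theorem continuous_heightInsert (S : Finset X) (a : X) : Continuous (P.heightInsert S a) := by
  classical
  refine continuous_iff_continuousAt.2 fun s => ?_
  refine P.tendsto_heightInsert S a (f := fun i s => if P.Cyl i a then s else 0) (K := |s| + 1)
    (fun i h => ?_) (fun i h => Eventually.of_forall fun y => if_neg h) ?_
  · simp only [if_pos h]
    exact tendsto_id
  · filter_upwards [(continuous_abs.tendsto s).eventually (gt_mem_nhds (lt_add_one |s|))]
      with t ht i
    split_ifs
    · exact ht.le
    · rw [abs_zero]
      positivity

variable [DecidableEq X]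

theorem peak_insert (i : ℕ) (S : Finset X) (b : X) :
    (P.peak i (insert b S) : ℝ) = max (P.weight i b : ℝ) (P.peak i S) := by
  rw [peak, Finset.sup_insert]
  exact NNReal.coe_max _ _

theorem height_insert_self (S : Finset X) (a : X) :
    P.height (insert a S) = P.heightInsert S a (P.φ a) := by
  refine tsum_congr fun i => ?_
  rw [peak_insert]
  split_ifs with h
  · rw [P.weight_of_cyl h]
  · rw [P.weight_of_not_cyl h, NNReal.coe_zero]

theorem tendsto_height_insert (S : Finset X) (a : X) (s : ℝ) :
    Tendsto (fun b => P.height (insert b S))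
      (comap (fun y i => P.u i y) (𝓝 fun i => P.u i a) ⊓ comap P.φ (𝓝 s))
      (𝓝 (P.heightInsert S a s)) := by
  simp only [height, peak_insert]
  have hφ : Tendsto P.φ (comap (fun y i => P.u i y) (𝓝 fun i => P.u i a) ⊓ comap P.φ (𝓝 s))
    (𝓝 s) := tendsto_comap.mono_left inf_le_right
  have hcyl : ∀ i, ∀ᶠ b in comap (fun y i => P.u i y) (𝓝 fun i => P.u i a) ⊓ comap P.φ (𝓝 s),
      (P.Cyl i a ↔ P.Cyl i b) := by
    intro i
    obtain ⟨n, hn⟩ := P.cyl_congr i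
    filter_upwards [mem_inf_of_left ((Near.hasBasis P.u a).mem_of_mem (i := n) trivial)] with b hb
    exact hn a b hb
  refine P.tendsto_heightInsert S a (f := fun i b => P.weight i b) (K := s + 1)
    (fun i h => hφ.congr' ?_) (fun i h => ?_) ?_
  · filter_upwards [hcyl i] with b hb
    rw [P.weight_of_cyl (hb.1 h)]
  · filter_upwards [hcyl i] with b hb
    rw [P.weight_of_not_cyl (hb.not.1 h), NNReal.coe_zero]
  · filter_upwards [hφ.eventually (gt_mem_nhds (lt_add_one s))] with b hb i
    rw [NNReal.abs_eq]
    exact ((NNReal.coe_le_coe.2 (P.weight_le i b)).trans_eq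
      (Real.coe_toNNReal _ (P.φ_nonneg b))).trans hb.le

theorem exists_height_insert_near (S : Finset X) (a : X) (s : ℝ) {ε : ℝ} (hε : 0 < ε) :
    ∃ n, ∃ η > 0, ∀ b, Near P.u n a b → |P.φ b - s| < η →
      |P.height (insert b S) - P.heightInsert S a s| < ε := by
  obtain ⟨⟨n, η⟩, ⟨-, hη⟩, h⟩ := ((Near.hasBasis P.u a).inf
    (Metric.nhds_basis_ball.comap P.φ)).mem_iff.1
    ((P.tendsto_height_insert S a s).eventually_mem (Metric.ball_mem_nhds _ hε))
  exact ⟨n, η, hη, fun b h1 h2 => h ⟨h1, h2⟩⟩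

theorem exists_replacement (S : Finset X) (a : X) (j m : ℕ) {δ : ℝ} (hδ : 0 ≤ δ) {ε : ℝ}
    (hε : 0 < ε) : ∃ b, Near P.u m a b ∧ (∀ k < j, P.L k b = P.L k a) ∧ P.L j b ≠ P.L j a ∧
      |P.height (insert b S) - P.height (insert a S) - δ| < ε := by
  obtain ⟨C, hC⟩ := P.exists_cyl_univ
  have hT : 0 ≤ P.height (insert a S) + δ := add_nonneg (P.height_nonneg _) hδ
  have hlow : ∀ s, 0 ≤ s → (1 / 2) ^ C * s ≤ P.heightInsert S a s :=
    fun s hs => P.le_heightInsert S a hC hs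
  obtain ⟨s, ⟨hs, -⟩, hs'⟩ : P.height (insert a S) + δ ∈ P.heightInsert S a ''
      Icc (P.φ a) (max (P.φ a) (2 ^ C * (P.height (insert a S) + δ))) := by
    refine intermediate_value_Icc (le_max_left _ _) (P.continuous_heightInsert S a).continuousOn
      ⟨?_, ?_⟩
    · rw [← height_insert_self]
      linarith
    · refine le_trans ?_ (hlow _ ((P.φ_nonneg a).trans (le_max_left _ _)))
      calc P.height (insert a S) + δ
          = (1 / 2) ^ C * (2 ^ C * (P.height (insert a S) + δ)) := by
            rw [← mul_assoc, ← mul_pow]; norm_num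
        _ ≤ _ := by gcongr; exact le_max_right _ _
  obtain ⟨n, η, hη, h⟩ := P.exists_height_insert_near S a s hε
  obtain ⟨b, hb, h1, h2, h3⟩ := P.exists_raise a j (max m n) (s - P.φ a) (by linarith) η hη
  refine ⟨b, hb.mono (le_max_left _ _), h1, h2, ?_⟩
  have := h b (hb.mono (le_max_right _ _)) (by rwa [sub_sub_sub_cancel_right] at h3)
  rwa [hs', ← sub_sub] at this

theorem close_insert {A B : FinHyp X} {S : Finset X} {a b : X} {m : ℕ}
    (hA : A.toFinset = insert a S) (hB : B.toFinset = insert b S) (h : Near P.u m a b) :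
    FinHyp.Close P.u m A B := by
  simp only [FinHyp.Close, ← FinHyp.mem_toFinset, hA, hB]
  refine ⟨fun c hc => ?_, fun c hc => ?_⟩
  · rcases Finset.mem_insert.1 hc with rfl | hc
    · exact ⟨b, Finset.mem_insert_self _ _, h⟩
    · exact ⟨c, Finset.mem_insert_of_mem hc, Near.refl _ _ _⟩
  · rcases Finset.mem_insert.1 hc with rfl | hc
    · exact ⟨a, Finset.mem_insert_self _ _, h⟩
    · exact ⟨c, Finset.mem_insert_of_mem hc, Near.refl _ _ _⟩

theorem finRank_insert {A B : FinHyp X} {S : Finset X} {a b : X} {n : ℕ}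
    (hA : A.toFinset = insert a S) (hB : B.toFinset = insert b S) (ha : a ∉ S) (hb : b ∉ S)
    (h : ∀ k < n, P.L k b = P.L k a) : ∀ k < n + 1, P.finRank k B = P.finRank k A := by
  rintro (_ | k) hk
  · rw [finRank, finRank, hA, hB, Finset.card_insert_of_notMem ha, Finset.card_insert_of_notMem hb]
  · rw [finRank, finRank, hA, hB, Finset.sup_insert, Finset.sup_insert, h k (by omega)]

theorem exists_finHyp_raise (A : FinHyp X) (j m : ℕ) {δ : ℝ} (hδ : 0 ≤ δ) {ε : ℝ} (hε : 0 < ε) :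
    ∃ B : FinHyp X, FinHyp.Close P.u m A B ∧ (∀ k < j, P.finRank k B = P.finRank k A) ∧
      P.finRank j B ≠ P.finRank j A ∧ |P.height B.toFinset - P.height A.toFinset - δ| < ε := by
  cases j with
  | zero =>
    obtain ⟨a, ha⟩ := A.nonempty_toFinset
    obtain ⟨n, hn⟩ := P.exists_separating_finset A.toFinset a
    obtain ⟨b, hb, -, hne, hh⟩ := P.exists_replacement A.toFinset a 0 (max m n) hδ hε
    have hbA : b ∉ A.toFinset := fun h => hne (by rw [hn b h (hb.mono (le_max_right _ _))])
    have hB := FinHyp.toFinset_ofFinset (insert b A.toFinset) (Finset.insert_nonempty _ _)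
    rw [Finset.insert_eq_of_mem ha] at hh
    refine ⟨_, P.close_insert (Finset.insert_eq_of_mem ha).symm hB (hb.mono (le_max_left _ _)),
      fun k hk => (Nat.not_lt_zero k hk).elim, ?_, by rwa [hB]⟩
    rw [finRank, finRank, hB, Finset.card_insert_of_notMem hbA]
    omega
  | succ j =>
    obtain ⟨a, ha, hmax⟩ := Finset.exists_mem_eq_sup _ A.nonempty_toFinset (P.L j)
    obtain ⟨n, hn⟩ := P.exists_separating_finset A.toFinset a
    obtain ⟨r, hr⟩ := P.L_lsc j a
    obtain ⟨b, hb, hlt, hne, hh⟩ :=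
      P.exists_replacement (A.toFinset.erase a) a j (max m (max n r)) hδ hε
    have hbA : b ∉ A.toFinset.erase a := fun h => hne (by
      rw [hn b (Finset.mem_of_mem_erase h)
        (hb.mono ((le_max_left _ _).trans (le_max_right _ _)))])
    have hB := FinHyp.toFinset_ofFinset (insert b (A.toFinset.erase a))
      (Finset.insert_nonempty _ _)
    have hA := (Finset.insert_erase ha).symm
    rw [← hA] at hh
    refine ⟨_, P.close_insert hA hB (hb.mono (le_max_left _ _)),
      P.finRank_insert hA hB (Finset.notMem_erase _ _) hbA hlt, ?_, by rwa [hB]⟩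
    rw [finRank, finRank, hB, hmax]
    have h1 := hr b (hb.mono ((le_max_right _ _).trans (le_max_right _ _)))
    have h2 : P.L j b ≤ (insert b (A.toFinset.erase a)).sup (P.L j) :=
      Finset.le_sup (Finset.mem_insert_self _ _)
    omega

theorem exists_finHyp_spread (A : FinHyp X) (n m : ℕ) {ε : ℝ} (hε : 0 < ε) :
    ∃ g : FinHyp X → ℕ, (∀ B, ∃ r, ∀ C, FinHyp.Close P.u r B C → g C = g B) ∧
      ∀ M, ∃ B : FinHyp X, FinHyp.Close P.u m A B ∧ (∀ k < n, P.finRank k B = P.finRank k A) ∧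
        P.height B.toFinset < P.height A.toFinset + ε ∧ M ≤ g B := by
  obtain ⟨a, ha⟩ := A.nonempty_toFinset
  have hA := (Finset.insert_erase ha).symm
  obtain ⟨n₁, hn₁⟩ := P.exists_separating_finset A.toFinset a
  obtain ⟨n₂, η, hη, hn₂⟩ := P.exists_height_insert_near (A.toFinset.erase a) a (P.φ a) hε
  obtain ⟨n₃, hn₃⟩ := P.φ_lsc a η hη
  obtain ⟨g, hg, hg'⟩ := P.exists_spread a n (max m (max n₁ (max n₂ n₃))) η hη
  choose r hr using hg
  refine ⟨fun B => B.toFinset.sup g, fun B => ⟨B.toFinset.sup r, fun C hC => ?_⟩, fun M => ?_⟩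
  · have key : ∀ b ∈ B.1, ∀ c, Near P.u (B.toFinset.sup r) b c → g c = g b := fun b hb c h =>
      hr b c (h.mono (Finset.le_sup (FinHyp.mem_toFinset.2 hb)))
    refine le_antisymm (Finset.sup_le fun c hc => ?_) (Finset.sup_le fun b hb => ?_)
    · obtain ⟨b, hb, h⟩ := hC.2 c (FinHyp.mem_toFinset.1 hc)
      rw [key b hb c h]
      exact Finset.le_sup (FinHyp.mem_toFinset.2 hb)
    · obtain ⟨c, hc, h⟩ := hC.1 b (FinHyp.mem_toFinset.1 hb)
      rw [← key b (FinHyp.mem_toFinset.1 hb) c h]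
      exact Finset.le_sup (FinHyp.mem_toFinset.2 hc)
  · obtain ⟨b, hb, hL, hφ, hM⟩ := hg' M
    have hb₁ : Near P.u n₁ a b := hb.mono (by simp)
    have hb₂ : Near P.u n₂ a b := hb.mono (by simp)
    have hb₃ : Near P.u n₃ a b := hb.mono (by simp)
    have hbA : b ∉ A.toFinset.erase a := fun h =>
      (Finset.mem_erase.1 h).1 (hn₁ b (Finset.mem_of_mem_erase h) hb₁)
    have hB := FinHyp.toFinset_ofFinset (insert b (A.toFinset.erase a))
      (Finset.insert_nonempty _ _)
    refine ⟨_, P.close_insert hA hB (hb.mono (le_max_left _ _)), fun k hk =>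
      P.finRank_insert hA hB (Finset.notMem_erase _ _) hbA hL k (hk.trans (Nat.lt_succ_self n)),
      ?_, ?_⟩
    · have h1 := hn₂ b hb₂ (abs_lt.2 ⟨by linarith [hn₃ b hb₃], by linarith⟩)
      rw [← height_insert_self, ← hA] at h1
      rw [hB]
      linarith [(abs_lt.1 h1).2]
    · refine hM.trans ?_
      dsimp only
      rw [hB]
      exact Finset.le_sup (Finset.mem_insert_self _ _)

/-- The presentation of the hyperspace of finite sets. -/
noncomputable def finHyp (hP : P.HasLimits) : ErdosPresentation (FinHyp X) where
  u := FinHyp.label P.u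
  L := P.finRank
  φ A := P.height A.toFinset
  φ_nonneg _ := P.height_nonneg _
  isInducing := isInducing_iff_nhds.2 fun A => by
    rw [nhds_prod_eq, Filter.prod_eq_inf, Filter.comap_inf, Filter.comap_comap,
      Filter.comap_comap, P.finHyp_nhds_eq]
    rfl
  ext_label A B h := P.finHyp_ext fun n => FinHyp.label_eq_iff.1 (h n)
  L_lsc k A := FinHyp.exists_near_imp (P.finRank_lsc k A)
  φ_lsc A _ hε := FinHyp.exists_near_imp (P.height_lsc A hε)
  exists_cluster s hM hs := (P.exists_finHyp_cluster hP s hM hs).imp fun _ h m =>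
    (h m).mono fun _ h => (FinHyp.near_label_succ_iff.2 h).mono (Nat.le_succ m)
  exists_raise A j m _ hδ _ hε := (P.exists_finHyp_raise A j m hδ hε).imp fun _ h =>
    ⟨(FinHyp.near_label_succ_iff.2 h.1).mono (Nat.le_succ m), h.2⟩
  exists_spread A n m _ hε := (P.exists_finHyp_spread A n m hε).imp fun _ h =>
    ⟨fun B => FinHyp.exists_near_imp (h.1 B), fun M => (h.2 M).imp fun _ h =>
      ⟨(FinHyp.near_label_succ_iff.2 h.1).mono (Nat.le_succ m), h.2⟩⟩

end ErdosPresentation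

/-- The Vietoris hyperspace `ℱ(𝔈)` of nonempty finite subsets of Erdős space `𝔈`
is homeomorphic to `𝔈`. -/
theorem finHyp_erdosSpace_homeomorph_erdosSpace :
    Nonempty (FinHyp ErdosSpace ≃ₜ ErdosSpace) := by
  classical
  have : Nonempty ErdosSpace := ⟨⟨0, fun _ => ⟨0, by simp⟩⟩⟩
  have : Nonempty (FinHyp ErdosSpace) := ⟨FinHyp.ofFinset {this.some} (Finset.singleton_nonempty _)⟩
  exact ErdosPresentation.nonempty_homeomorph
    (ErdosSpace.presentation.finHyp ErdosSpace.exists_limit) ErdosSpace.presentation
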